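/- arXiv:1002.2624 — 4 statements merged into one kernel-verified Lean document; each statement's English description precedes it below -/
import Mathlib

section
/- Let C be a symmetric rigid monoidal category over a field k with symmetry c, let X be an object of C, and let m ≥ 1. Identify S_{m-1} with the stabilizer of 1 in S_m. Then for any σ ∈ S_m and any τ ∈ S_{m-1}, one has Tr^{X^{⊗(m-1)}}_{X,X}(ρ(σ)) = Tr^{X^{⊗(m-1)}}_{X,X}(ρ(τστ^{-1})), where ρ : S_m → Aut(X^{⊗m}) is the action by permutation of tensor factors via the symmetry, and X^{⊗m} is viewed as X ⊗ X^{⊗(m-1)}. -/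
open CategoryTheory MonoidalCategory

variable {C : Type*} [Category C] [MonoidalCategory C]

/-- The `n`-th tensor power `X^{⊗n}` of an object of a monoidal category. -/
def tpow (X : C) : ℕ → C
  | 0 => 𝟙_ C
  | n + 1 => X ⊗ tpow X n

/-- The braiding of the `i`-th and `(i+1)`-th tensor factors of `X^{⊗m}`
(positions `0`-indexed). -/
def adjSwap [BraidedCategory C] (X : C) : (m : ℕ) → ℕ → (tpow X m ⟶ tpow X m)
  | 0, _ => 𝟙 _
  | 1, _ => 𝟙 _
  | m + 2, 0 =>
      (α_ X X (tpow X m)).inv ≫ ((β_ X X).hom ▷ tpow X m) ≫ (α_ X X (tpow X m)).hom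
  | m + 2, i + 1 => X ◁ adjSwap X (m + 1) i

/-- `ρ : S_m →* End (X^{⊗m})` is *the* action of the symmetric group permuting the
tensor factors via the symmetry iff it sends each adjacent transposition `(i, i+1)` to
the braiding of the corresponding adjacent tensor factors (these transpositions generate
`S_m`, so this characterizes the action uniquely). -/
def IsPermAction [BraidedCategory C] (X : C) (m : ℕ)
    (ρ : Equiv.Perm (Fin m) →* CategoryTheory.End (tpow X m)) : Prop :=
  ∀ (i : ℕ) (h : i + 1 < m),
    ρ (Equiv.swap ⟨i, Nat.lt_of_succ_lt h⟩ ⟨i + 1, h⟩) = adjSwap X m i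

/-- The partial trace `Tr^U_{A,B}(f) := (id_B ⊗ ẽv_U) ∘ (f ⊗ id_{U*}) ∘ (id_A ⊗ coev_U)`
of `f : A ⊗ U ⟶ B ⊗ U` in a symmetric rigid monoidal category, where
`ẽv_U := ev_U ∘ c_{U,U*}`. -/
def ptrace [SymmetricCategory C] [RigidCategory C] (A B U : C) (f : A ⊗ U ⟶ B ⊗ U) :
    A ⟶ B :=
  (ρ_ A).inv ≫ (A ◁ η_ U (Uᘁ)) ≫ (α_ A U (Uᘁ)).inv ≫ (f ▷ (Uᘁ)) ≫
    (α_ B U (Uᘁ)).hom ≫ (B ◁ ((β_ U (Uᘁ)).hom ≫ ε_ U (Uᘁ))) ≫ (ρ_ B).hom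

/-- The embedding of `S_m` into `S_{m+1}` as the stabilizer of the first point `0`. -/
def embSucc (m : ℕ) : Equiv.Perm (Fin m) →* Equiv.Perm (Fin (m + 1)) where
  toFun τ := (finSuccEquiv m).symm.permCongr τ.optionCongr
  map_one' := by ext x; simp
  map_mul' τ₁ τ₂ := by ext x; simp [Equiv.permCongr_apply]

/-- Endomorphisms of the traced-out factor move around the partial trace. -/
lemma ptrace_comp_whiskerLeft [SymmetricCategory C] [RigidCategory C] {A B U : C}
    (f : A ⊗ U ⟶ B ⊗ U) (g : U ⟶ U) :
    ptrace A B U (f ≫ B ◁ g) = ptrace A B U (A ◁ g ≫ f) := by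
  have hη : η_ U (Uᘁ) ≫ g ▷ (Uᘁ) = η_ U (Uᘁ) ≫ U ◁ (gᘁ) :=
    (coevaluation_comp_rightAdjointMate g).symm
  have hε : g ▷ (Uᘁ) ≫ (β_ U (Uᘁ)).hom ≫ ε_ U (Uᘁ) =
      U ◁ (gᘁ) ≫ (β_ U (Uᘁ)).hom ≫ ε_ U (Uᘁ) := by
    rw [BraidedCategory.braiding_naturality_left_assoc,
      BraidedCategory.braiding_naturality_right_assoc, rightAdjointMate_comp_evaluation]
  calc
    ptrace A B U (f ≫ B ◁ g) = (ρ_ A).inv ≫ (A ◁ η_ U (Uᘁ)) ≫ (α_ A U (Uᘁ)).inv ≫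
        (f ▷ (Uᘁ)) ≫ (α_ B U (Uᘁ)).hom ≫
          (B ◁ (g ▷ (Uᘁ) ≫ (β_ U (Uᘁ)).hom ≫ ε_ U (Uᘁ))) ≫ (ρ_ B).hom := by
      simp only [ptrace, comp_whiskerRight, MonoidalCategory.whiskerLeft_comp, Category.assoc,
        associator_naturality_middle_assoc]
    _ = (ρ_ A).inv ≫ (A ◁ (η_ U (Uᘁ) ≫ U ◁ (gᘁ))) ≫ (α_ A U (Uᘁ)).inv ≫
        (f ▷ (Uᘁ)) ≫ (α_ B U (Uᘁ)).hom ≫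
          (B ◁ ((β_ U (Uᘁ)).hom ≫ ε_ U (Uᘁ))) ≫ (ρ_ B).hom := by
      rw [hε]
      simp only [MonoidalCategory.whiskerLeft_comp, Category.assoc,
        associator_inv_naturality_right_assoc, whisker_exchange_assoc,
        associator_naturality_right_assoc]
    _ = ptrace A B U (A ◁ g ≫ f) := by
      rw [← hη]
      simp [ptrace]

lemma embSucc_swap {m : ℕ} (i j : Fin m) :
    embSucc m (Equiv.swap i j) = Equiv.swap i.succ j.succ := by
  ext x
  refine Fin.cases ?_ (fun y => ?_) x
  · simp [embSucc, Equiv.permCongr_apply, Equiv.swap_apply_of_ne_of_ne, (Fin.succ_ne_zero _).symm]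
  · simp [embSucc, Equiv.permCongr_apply, ← (Fin.succ_injective m).map_swap,
      ← (Option.some_injective (Fin m)).map_swap]

/-- A permutation fixing the first point acts on the remaining tensor factors only. -/
lemma IsPermAction.exists_whiskerLeft [BraidedCategory C] {X : C} {m : ℕ}
    {ρ : Equiv.Perm (Fin (m + 1)) →* CategoryTheory.End (tpow X (m + 1))}
    (hρ : IsPermAction X (m + 1) ρ) (τ : Equiv.Perm (Fin m)) :
    ∃ g : tpow X m ⟶ tpow X m, ρ (embSucc m τ) = X ◁ g := by
  cases m with
  | zero =>
    refine ⟨𝟙 _, ?_⟩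
    rw [Subsingleton.elim τ 1, map_one, map_one, MonoidalCategory.whiskerLeft_id]
    rfl
  | succ n =>
    have hτ : τ ∈ Submonoid.closure
        (Set.range fun i : Fin n => Equiv.swap i.castSucc i.succ) := by
      rw [Equiv.Perm.mclosure_swap_castSucc_succ]
      trivial
    induction hτ using Submonoid.closure_induction with
    | mem _ h =>
      obtain ⟨i, rfl⟩ := h
      refine ⟨adjSwap X (n + 1) i, ?_⟩
      rw [embSucc_swap]
      exact hρ (i + 1) (by omega)
    | one =>
      refine ⟨𝟙 _, ?_⟩
      rw [map_one, map_one, MonoidalCategory.whiskerLeft_id]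
      rfl
    | mul a b _ _ ha hb =>
      obtain ⟨ga, ha⟩ := ha
      obtain ⟨gb, hb⟩ := hb
      refine ⟨gb ≫ ga, ?_⟩
      rw [map_mul, map_mul, ha, hb, MonoidalCategory.whiskerLeft_comp]
      rfl

/-- Let `C` be a `k`-linear symmetric rigid monoidal category, `X : C`,
and view `X^{⊗(m+1)}` as `X ⊗ X^{⊗m}`.  For the action `ρ` of `S_{m+1}` on `X^{⊗(m+1)}`
permuting tensor factors via the symmetry, and for any `σ ∈ S_{m+1}` and any `τ` in the
stabilizer of the first point (identified with `S_m`), one has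
`Tr^{X^{⊗m}}_{X,X}(ρ σ) = Tr^{X^{⊗m}}_{X,X}(ρ (τστ⁻¹))`. -/
theorem ptrace_conj_invariant
    {k : Type*} [Field k] [Preadditive C] [Linear k C]
    [MonoidalPreadditive C] [MonoidalLinear k C]
    [SymmetricCategory C] [RigidCategory C] (X : C) (m : ℕ)
    (ρ : Equiv.Perm (Fin (m + 1)) →* CategoryTheory.End (tpow X (m + 1)))
    (hρ : IsPermAction X (m + 1) ρ) (σ : Equiv.Perm (Fin (m + 1)))
    (τ : Equiv.Perm (Fin m)) :
    ptrace X X (tpow X m) (ρ σ) =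
      ptrace X X (tpow X m) (ρ (embSucc m τ * σ * (embSucc m τ)⁻¹)) := by
  obtain ⟨g, hg⟩ := hρ.exists_whiskerLeft τ
  have h_conj : ρ (embSucc m τ * σ * (embSucc m τ)⁻¹) =
      (ρ (σ * (embSucc m τ)⁻¹) : tpow X (m + 1) ⟶ tpow X (m + 1)) ≫ X ◁ g := by
    rw [mul_assoc, map_mul, hg]
    rfl
  have h_cancel : X ◁ g ≫ (ρ (σ * (embSucc m τ)⁻¹) : tpow X (m + 1) ⟶ tpow X (m + 1)) =
      ρ σ := by
    rw [← hg]
    change ρ (σ * (embSucc m τ)⁻¹) * ρ (embSucc m τ) = ρ σ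
    rw [← map_mul, inv_mul_cancel_right]
  rw [h_conj]
  exact ((ptrace_comp_whiskerLeft _ g).trans (congrArg _ h_cancel)).symm
end

section
/- Let C be a symmetric rigid monoidal category over a field k with symmetry c, let X be an object of C, and let m ≥ 1. Let σ_m = (1 2 ⋯ m) ∈ S_m be the full cycle. Then Tr^{X^{⊗(m-1)}}_{X,X}(ρ(σ_m)) = id_X, where ρ(σ_m) is the automorphism of X^{⊗m} = X ⊗ X^{⊗(m-1)} given by the action of σ_m permuting tensor factors via the symmetry. -/
open CategoryTheory MonoidalCategory

variable {C : Type*} [Category C] [MonoidalCategory C]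

section PartialTrace

open BraidedCategory

/-- The partial trace of `f : A ⊗ U ⟶ B ⊗ U` computed with an arbitrary dual `V` of `U`. -/
def ptraceOfPairing [BraidedCategory C] (A B U V : C) [ExactPairing U V] (f : A ⊗ U ⟶ B ⊗ U) :
    A ⟶ B :=
  (ρ_ A).inv ≫ (A ◁ η_ U V) ≫ (α_ A U V).inv ≫ (f ▷ V) ≫
    (α_ B U V).hom ≫ (B ◁ ((β_ U V).hom ≫ ε_ U V)) ≫ (ρ_ B).hom

/-- The partial trace does not depend on the choice of a dual. -/
lemma ptraceOfPairing_eq [BraidedCategory C] {A B U V W : C} (p : ExactPairing U V)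
    (q : ExactPairing U W) (f : A ⊗ U ⟶ B ⊗ U) :
    ptraceOfPairing A B U V f = ptraceOfPairing A B U W f := by
  obtain ⟨u, hη, hε⟩ : ∃ u : V ⟶ W, η_ U V ≫ U ◁ u = η_ U W ∧ u ▷ U ≫ ε_ U W = ε_ U V := by
    let dV : HasRightDual U := { rightDual := V, exact := p }
    let dW : HasRightDual U := { rightDual := W, exact := q }
    refine ⟨@rightAdjointMate _ _ _ U U dW dV (𝟙 U), ?_, ?_⟩
    · have h := @coevaluation_comp_rightAdjointMate _ _ _ U U dW dV (𝟙 U)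
      rw [id_whiskerRight, Category.comp_id] at h
      exact h
    · have h := @rightAdjointMate_comp_evaluation _ _ _ U U dW dV (𝟙 U)
      rw [MonoidalCategory.whiskerLeft_id, Category.id_comp] at h
      exact h
  unfold ptraceOfPairing
  have hβ : (β_ U V).hom ≫ ε_ U V = U ◁ u ≫ (β_ U W).hom ≫ ε_ U W := by
    rw [← hε, braiding_naturality_right_assoc]
  rw [hβ, ← hη]
  calc
    _ = (ρ_ A).inv ≫ A ◁ η_ U V ≫ (α_ A U V).inv ≫ (f ▷ V ≫ (B ⊗ U) ◁ u) ≫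
        (α_ B U W).hom ≫ B ◁ ((β_ U W).hom ≫ ε_ U W) ≫ (ρ_ B).hom := by monoidal
    _ = _ := by rw [← whisker_exchange]; monoidal

/-- The twisted evaluation of a tensor product of dual pairs is obtained by nesting. -/
lemma braiding_comp_evaluation_tensor [SymmetricCategory C] (X U W Z : C) [ExactPairing X W]
    [ExactPairing U Z] :
    (β_ (X ⊗ U) (Z ⊗ W)).hom ≫ ε_ (X ⊗ U) (Z ⊗ W) =
      𝟙 _ ⊗≫ X ◁ ((β_ U Z).hom ≫ ε_ U Z) ▷ W ⊗≫ ((β_ X W).hom ≫ ε_ X W) := by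
  have hslide : X ◁ (β_ U W).hom ⊗≫ ((β_ X W).hom ≫ ε_ X W) ▷ U =
      𝟙 _ ⊗≫ (β_ X U).hom ▷ W ⊗≫ U ◁ ((β_ X W).hom ≫ ε_ X W) ⊗≫ 𝟙 _ := by
    have h := braiding_naturality_right U ((β_ X W).hom ≫ ε_ X W)
    rw [braiding_tensor_right_hom, braiding_tensorUnit_right] at h
    calc
      _ = 𝟙 _ ⊗≫ ((β_ X U).hom ≫ (β_ U X).hom) ▷ W ⊗≫ X ◁ (β_ U W).hom ⊗≫
          ((β_ X W).hom ≫ ε_ X W) ▷ U := by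
        rw [SymmetricCategory.symmetry]; monoidal
      _ = 𝟙 _ ⊗≫ (β_ X U).hom ▷ W ⊗≫ (((α_ U X W).inv ≫ (β_ U X).hom ▷ W ≫ (α_ X U W).hom ≫
          X ◁ (β_ U W).hom ≫ (α_ X W U).inv) ≫ ((β_ X W).hom ≫ ε_ X W) ▷ U) ⊗≫ 𝟙 _ := by monoidal
      _ = _ := by rw [← h]; monoidal
  have hpull : (X ◁ ε_ U Z) ⊗≫ 𝟙 X =
      𝟙 _ ⊗≫ (β_ X Z).hom ▷ U ⊗≫ Z ◁ (β_ X U).hom ⊗≫ ε_ U Z ▷ X ⊗≫ 𝟙 _ := by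
    have h := braiding_naturality_right X (ε_ U Z)
    rw [braiding_tensor_right_hom, braiding_tensorUnit_right] at h
    calc
      _ = (X ◁ ε_ U Z ≫ (ρ_ X).hom ≫ (λ_ X).inv) ⊗≫ 𝟙 X := by monoidal
      _ = _ := by rw [h]; monoidal
  rw [ExactPairing.tensor_evaluation, braiding_tensor_right_hom, braiding_tensor_left_hom,
    braiding_tensor_left_hom]
  calc
    _ = 𝟙 _ ⊗≫ X ◁ (β_ U Z).hom ▷ W ⊗≫ (β_ X Z).hom ▷ U ▷ W ⊗≫
        Z ◁ (X ◁ (β_ U W).hom ⊗≫ ((β_ X W).hom ≫ ε_ X W) ▷ U) ⊗≫ ε_ U Z := by monoidal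
    _ = 𝟙 _ ⊗≫ X ◁ (β_ U Z).hom ▷ W ⊗≫ (β_ X Z).hom ▷ U ▷ W ⊗≫ Z ◁ (β_ X U).hom ▷ W ⊗≫
        ((Z ⊗ U) ◁ ((β_ X W).hom ≫ ε_ X W) ≫ ε_ U Z ▷ 𝟙_ C) ⊗≫ 𝟙 _ := by
      rw [hslide]; monoidal
    _ = 𝟙 _ ⊗≫ X ◁ (β_ U Z).hom ▷ W ⊗≫ (𝟙 (X ⊗ Z ⊗ U) ⊗≫ (β_ X Z).hom ▷ U ⊗≫ Z ◁ (β_ X U).hom ⊗≫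
        ε_ U Z ▷ X ⊗≫ 𝟙 X) ▷ W ⊗≫ ((β_ X W).hom ≫ ε_ X W) := by
      rw [whisker_exchange]; monoidal
    _ = _ := by rw [← hpull]; monoidal

/-- The partial trace over `X ⊗ U` is the iterated partial trace over `U` and then `X`. -/
lemma ptraceOfPairing_tensor [SymmetricCategory C] (A B X U W Z : C) [ExactPairing X W]
    [ExactPairing U Z] (f : A ⊗ X ⊗ U ⟶ B ⊗ X ⊗ U) :
    ptraceOfPairing A B (X ⊗ U) (Z ⊗ W) f =
      ptraceOfPairing A B X W (ptraceOfPairing (A ⊗ X) (B ⊗ X) U Z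
        ((α_ A X U).hom ≫ f ≫ (α_ B X U).inv)) := by
  unfold ptraceOfPairing
  rw [braiding_comp_evaluation_tensor, ExactPairing.tensor_coevaluation]
  monoidal

/-- The partial trace is natural in the codomain. -/
lemma ptraceOfPairing_comp_whiskerRight [BraidedCategory C] {A B B' U V : C} [ExactPairing U V]
    (f : A ⊗ U ⟶ B ⊗ U) (g : B ⟶ B') :
    ptraceOfPairing A B' U V (f ≫ g ▷ U) = ptraceOfPairing A B U V f ≫ g := by
  unfold ptraceOfPairing
  calc
    _ = (ρ_ A).inv ≫ A ◁ η_ U V ≫ (α_ A U V).inv ≫ f ▷ V ≫ (α_ B U V).hom ≫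
        (g ▷ (U ⊗ V) ≫ B' ◁ ((β_ U V).hom ≫ ε_ U V)) ≫ (ρ_ B').hom := by monoidal
    _ = _ := by rw [← whisker_exchange]; monoidal

/-- The partial trace commutes with whiskering on the left. -/
lemma ptraceOfPairing_whiskerLeft [BraidedCategory C] (Y : C) {A B U V : C} [ExactPairing U V]
    (f : A ⊗ U ⟶ B ⊗ U) :
    ptraceOfPairing (Y ⊗ A) (Y ⊗ B) U V ((α_ Y A U).hom ≫ Y ◁ f ≫ (α_ Y B U).inv) =
      Y ◁ ptraceOfPairing A B U V f := by
  unfold ptraceOfPairing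
  monoidal

/-- Yanking: the partial trace of the braiding is the identity. -/
lemma ptraceOfPairing_braiding [BraidedCategory C] (X V : C) [ExactPairing X V] :
    ptraceOfPairing X X X V (β_ X X).hom = 𝟙 X := by
  have h := braiding_naturality_right X (η_ X V)
  rw [braiding_tensor_right_hom, braiding_tensorUnit_right] at h
  unfold ptraceOfPairing
  calc
    _ = (ρ_ X).inv ≫ (X ◁ η_ X V ≫ (α_ X X V).inv ≫ (β_ X X).hom ▷ V ≫ (α_ X X V).hom ≫
        X ◁ (β_ X V).hom ≫ (α_ X V X).inv) ≫ (α_ X V X).hom ≫ X ◁ ε_ X V ≫ (ρ_ X).hom := by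
      monoidal
    _ = (λ_ X).inv ≫ (η_ X V ▷ X ≫ (α_ X V X).hom ≫ X ◁ ε_ X V) ≫ (ρ_ X).hom := by
      rw [h]; monoidal
    _ = 𝟙 X := by rw [ExactPairing.evaluation_coevaluation]; monoidal

lemma ptraceOfPairing_unit [BraidedCategory C] (X : C) :
    ptraceOfPairing X X (𝟙_ C) (𝟙_ C) (𝟙 _) = 𝟙 X := by
  have hη : η_ (𝟙_ C) (𝟙_ C) = (ρ_ _).inv := rfl
  have hε : ε_ (𝟙_ C) (𝟙_ C) = (ρ_ _).hom := rfl
  unfold ptraceOfPairing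
  rw [hη, hε, braiding_tensorUnit_right]
  monoidal

/-- Prepending a strand and braiding it with the first one preserves having partial trace the
identity. -/
lemma ptraceOfPairing_whiskerLeft_comp_braiding [SymmetricCategory C] (X : C) {U W Z : C}
    [ExactPairing X W] [ExactPairing U Z] (f : X ⊗ U ⟶ X ⊗ U)
    (hf : ptraceOfPairing X X U Z f = 𝟙 X) :
    ptraceOfPairing X X (X ⊗ U) (Z ⊗ W)
      (X ◁ f ≫ (α_ X X U).inv ≫ (β_ X X).hom ▷ U ≫ (α_ X X U).hom) = 𝟙 X := by
  have h : (α_ X X U).hom ≫ (X ◁ f ≫ (α_ X X U).inv ≫ (β_ X X).hom ▷ U ≫ (α_ X X U).hom) ≫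
      (α_ X X U).inv = ((α_ X X U).hom ≫ X ◁ f ≫ (α_ X X U).inv) ≫ (β_ X X).hom ▷ U := by
    simp
  rw [ptraceOfPairing_tensor, h, ptraceOfPairing_comp_whiskerRight, ptraceOfPairing_whiskerLeft,
    hf, MonoidalCategory.whiskerLeft_id, Category.id_comp, ptraceOfPairing_braiding]

end PartialTrace

/-- The full cycle of `Fin (n + 1)` is the product of the adjacent transpositions
`(0 1) (1 2) ⋯ (n-1 n)`. -/
lemma finRotate_eq_prod_swap (n : ℕ) :
    finRotate (n + 1) = (List.ofFn fun i : Fin n => Equiv.swap i.castSucc i.succ).prod := by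
  have hprod : (List.ofFn fun i : Fin n => Equiv.swap i.castSucc i.succ).prod =
      (List.finRange (n + 1)).formPerm := by
    refine congrArg List.prod (List.ext_getElem (by simp) fun i h₁ h₂ => ?_)
    simp
  rw [hprod]
  ext i
  have h := List.formPerm_apply_getElem (List.finRange (n + 1)) (List.nodup_finRange _) i
    (by simpa using i.is_le)
  simp only [List.getElem_finRange, List.length_finRange, Fin.cast_mk, Fin.eta] at h
  rw [h, finRotate_apply]
  simp [Fin.val_add]

/-- The endomorphism of `X^{⊗(m+1)}` moving the last tensor factor to the front. -/
def cycleMap [BraidedCategory C] (X : C) : (m : ℕ) → CategoryTheory.End (tpow X (m + 1))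
  | 0 => 𝟙 _
  | m + 1 => (X ◁ cycleMap X m : tpow X (m + 2) ⟶ tpow X (m + 2)) ≫ adjSwap X (m + 2) 0

lemma cycleMap_eq_prod [BraidedCategory C] (X : C) (m : ℕ) :
    cycleMap X m =
      (List.ofFn (α := CategoryTheory.End (tpow X (m + 1))) fun i : Fin m =>
        adjSwap X (m + 1) i).prod := by
  induction m with
  | zero => rfl
  | succ m ih =>
    have hmap := map_list_prod (Functor.mapEnd (tpow X (m + 1)) (tensorLeft X))
      (List.ofFn (α := CategoryTheory.End (tpow X (m + 1))) fun i : Fin m => adjSwap X (m + 1) i)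
    rw [← ih, List.map_ofFn] at hmap
    rw [List.ofFn_succ, List.prod_cons]
    exact congrArg (HMul.hMul (α := CategoryTheory.End (tpow X (m + 2)))
      (β := CategoryTheory.End (tpow X (m + 2))) (adjSwap X (m + 2) 0)) hmap

lemma ptraceOfPairing_cycleMap [SymmetricCategory C] [RigidCategory C] (X : C) (m : ℕ) :
    ptraceOfPairing X X (tpow X m) ((tpow X m)ᘁ) (cycleMap X m) = 𝟙 X := by
  induction m with
  | zero =>
    exact (ptraceOfPairing_eq _ exactPairingUnit _).trans (ptraceOfPairing_unit X)
  | succ m ih =>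
    refine (ptraceOfPairing_eq _ (ExactPairing.tensor (X₁ := X) (Y₁ := Xᘁ) (X₂ := tpow X m)
      (Y₂ := (tpow X m)ᘁ)) _).trans ?_
    exact ptraceOfPairing_whiskerLeft_comp_braiding X _ ih

/-- Let `C` be a `k`-linear symmetric rigid monoidal category, `X : C`,
and view `X^{⊗(m+1)}` as `X ⊗ X^{⊗m}`.  For the action `ρ` of `S_{m+1}` on
`X^{⊗(m+1)}` permuting tensor factors via the symmetry, the partial trace of the full
cycle `(0 1 ⋯ m)` (i.e. `(1 2 ⋯ m)` in the paper's 1-indexed notation) is the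
identity: `Tr^{X^{⊗m}}_{X,X}(ρ (0 1 ⋯ m)) = id_X`. -/
theorem ptrace_fullCycle
    {k : Type*} [Field k] [Preadditive C] [Linear k C]
    [MonoidalPreadditive C] [MonoidalLinear k C]
    [SymmetricCategory C] [RigidCategory C] (X : C) (m : ℕ)
    (ρ : Equiv.Perm (Fin (m + 1)) →* CategoryTheory.End (tpow X (m + 1)))
    (hρ : IsPermAction X (m + 1) ρ) :
    ptrace X X (tpow X m) (ρ (finRotate (m + 1))) = 𝟙 X := by
  have h : ρ (finRotate (m + 1)) = cycleMap X m := by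
    rw [finRotate_eq_prod_swap, cycleMap_eq_prod, map_list_prod, List.map_ofFn]
    exact congrArg (fun s => (List.ofFn s).prod)
      (funext fun i => hρ i (Nat.succ_lt_succ i.isLt))
  rw [h]
  exact ptraceOfPairing_cycleMap X m
end

section
/- Let C be a symmetric rigid monoidal category over a field k with symmetry c and End(1) = k, let X be an object of C of dimension d := ẽv_X ∘ coev_X ∈ k, and let m ≥ 1. Suppose σ ∈ S_m is a product σ_1 σ_2 ⋯ σ_N of N disjoint cycles such that, reading the cycle decomposition from left to right, the numbers 1, …, m appear in increasing order (i.e., each σ_i cyclically permutes a block of consecutive integers, the blocks partition {1,…,m}, and are arranged in increasing order). Then Tr^{X^{⊗(m-1)}}_{X,X}(ρ(σ)) = d^{N-1} · id_X. -/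
open CategoryTheory MonoidalCategory

variable {C : Type*} [Category C] [MonoidalCategory C]

/-- The permutation of `Fin l.sum` that is the product of disjoint cycles whose supports
are the consecutive blocks of sizes `l = [l₁, …, l_N]` (in increasing order), each block
being cyclically rotated; i.e. reading the cycle decomposition from left to right the
numbers appear in increasing order. -/
def blockCyclePerm : (l : List ℕ) → Equiv.Perm (Fin l.sum)
  | [] => 1
  | a :: rest =>
    (((finSumFinEquiv (m := a) (n := rest.sum)).trans
        (finCongr (by simp))).permCongr
      (Equiv.sumCongr (finRotate a) (blockCyclePerm rest)))

section Trace

variable [SymmetricCategory C]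

/-- The evaluation `U ⊗ V ⟶ 𝟙` obtained from an exact pairing `(U, V)` and the symmetry. -/
def evTilde (U V : C) [ExactPairing U V] : U ⊗ V ⟶ 𝟙_ C := (β_ U V).hom ≫ ε_ U V

/-- The partial trace computed with an arbitrary exact pairing `(U, V)`. -/
def pairingTrace (A B U V : C) [ExactPairing U V] (f : A ⊗ U ⟶ B ⊗ U) : A ⟶ B :=
  (ρ_ A).inv ≫ A ◁ η_ U V ≫ (α_ A U V).inv ≫ f ▷ V ≫
    (α_ B U V).hom ≫ B ◁ evTilde U V ≫ (ρ_ B).hom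

lemma ptrace_eq_pairingTrace [RigidCategory C] {A B U : C} (f : A ⊗ U ⟶ B ⊗ U) :
    ptrace A B U f = pairingTrace A B U (Uᘁ) f := rfl

lemma pairingTrace_congr {A B U V W : C} (p : ExactPairing U V) (q : ExactPairing U W)
    (f : A ⊗ U ⟶ B ⊗ U) :
    @pairingTrace _ _ _ _ A B U V p f = @pairingTrace _ _ _ _ A B U W q f := by
  obtain ⟨φ, hη, hε⟩ : ∃ φ : V ⟶ W, η_ U V ≫ U ◁ φ = η_ U W ∧ φ ▷ U ≫ ε_ U W = ε_ U V := by
    refine ⟨@rightAdjointMate C _ _ U U ⟨W⟩ ⟨V⟩ (𝟙 U), ?_, ?_⟩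
    · simpa using @coevaluation_comp_rightAdjointMate C _ _ U U ⟨W⟩ ⟨V⟩ (𝟙 U)
    · simpa using @rightAdjointMate_comp_evaluation C _ _ U U ⟨W⟩ ⟨V⟩ (𝟙 U)
  have hev : evTilde U V = U ◁ φ ≫ evTilde U W := by
    simp [evTilde, ← hε]
  simp only [pairingTrace, hev, ← hη, MonoidalCategory.whiskerLeft_comp, Category.assoc,
    associator_inv_naturality_right_assoc, whisker_exchange_assoc,
    associator_naturality_right_assoc]

lemma whiskerLeft_braiding_evTilde (U V W : C) [ExactPairing U V] :
    U ◁ (β_ W V).hom ⊗≫ evTilde U V ▷ W =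
      𝟙 _ ⊗≫ (β_ U W).hom ▷ V ⊗≫ W ◁ evTilde U V ⊗≫ 𝟙 (𝟙_ C ⊗ W) := by
  have h := BraidedCategory.braiding_naturality_right W (evTilde U V)
  rw [BraidedCategory.braiding_tensor_right_hom, braiding_tensorUnit_right] at h
  have h' := congrArg (fun t => (α_ _ _ _).inv ≫
    (β_ U W).hom ▷ V ≫ (α_ _ _ _).hom ≫ t ≫ (λ_ W).hom) h
  simp [← comp_whiskerRight_assoc] at h'
  simp [monoidalComp, reassoc_of% h']

lemma evTilde_tensor (U V W Z : C) [ExactPairing U V] [ExactPairing W Z] :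
    evTilde (U ⊗ W) (Z ⊗ V) =
      𝟙 _ ⊗≫ U ◁ (evTilde W Z ▷ V) ⊗≫ evTilde U V := by
  have hn : (β_ U (Z ⊗ W)).hom ≫ ε_ W Z ▷ U = U ◁ ε_ W Z ≫ (β_ U (𝟙_ C)).hom :=
    (BraidedCategory.braiding_naturality_right U (ε_ W Z)).symm
  calc
    evTilde (U ⊗ W) (Z ⊗ V) =
      𝟙 _ ⊗≫ U ◁ (β_ W Z).hom ▷ V ⊗≫ (β_ U Z).hom ▷ (W ⊗ V) ⊗≫
        Z ◁ (U ◁ (β_ W V).hom ⊗≫ evTilde U V ▷ W) ⊗≫ ε_ W Z := by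
      simp only [evTilde, ExactPairing.tensor_evaluation, BraidedCategory.braiding_tensor_left_hom,
        BraidedCategory.braiding_tensor_right_hom]
      simp [monoidalComp]
    _ = 𝟙 _ ⊗≫ U ◁ (β_ W Z).hom ▷ V ⊗≫ (β_ U (Z ⊗ W)).hom ▷ V ⊗≫
        ((Z ⊗ W) ◁ evTilde U V ≫ ε_ W Z ▷ (𝟙_ C)) ⊗≫ 𝟙 _ := by
      rw [whiskerLeft_braiding_evTilde, BraidedCategory.braiding_tensor_right_hom]
      monoidal
    _ = 𝟙 _ ⊗≫ U ◁ (β_ W Z).hom ▷ V ⊗≫ ((β_ U (Z ⊗ W)).hom ≫ ε_ W Z ▷ U) ▷ V ⊗≫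
        evTilde U V := by
      rw [whisker_exchange]; monoidal
    _ = _ := by
      rw [hn, braiding_tensorUnit_right, evTilde.eq_1 W]
      monoidal

lemma pairingTrace_tensor {A B U V W Z : C} [ExactPairing U V] [ExactPairing W Z]
    (f : A ⊗ (U ⊗ W) ⟶ B ⊗ (U ⊗ W)) :
    pairingTrace A B (U ⊗ W) (Z ⊗ V) f =
      pairingTrace A B U V (pairingTrace (A ⊗ U) (B ⊗ U) W Z
        ((α_ A U W).hom ≫ f ≫ (α_ B U W).inv)) := by
  simp only [pairingTrace, evTilde_tensor, ExactPairing.tensor_coevaluation]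
  monoidal

lemma pairingTrace_comp {A B D U V : C} [ExactPairing U V] (f : A ⊗ U ⟶ B ⊗ U) (g : B ⟶ D) :
    pairingTrace A D U V (f ≫ g ▷ U) = pairingTrace A B U V f ≫ g := by
  have h : (g ▷ U) ▷ V ≫ (α_ D U V).hom ≫ D ◁ evTilde U V ≫ (ρ_ D).hom =
      (α_ B U V).hom ≫ B ◁ evTilde U V ≫ (ρ_ B).hom ≫ g := by
    rw [associator_naturality_left_assoc, ← whisker_exchange_assoc, rightUnitor_naturality]
  simp only [pairingTrace, comp_whiskerRight, Category.assoc, h]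

lemma pairingTrace_whiskerLeft (E : C) {A B U V : C} [ExactPairing U V] (f : A ⊗ U ⟶ B ⊗ U) :
    pairingTrace (E ⊗ A) (E ⊗ B) U V ((α_ E A U).hom ≫ E ◁ f ≫ (α_ E B U).inv) =
      E ◁ pairingTrace A B U V f := by
  simp only [pairingTrace]
  monoidal

lemma pairingTrace_braiding (U V : C) [ExactPairing U V] :
    pairingTrace U U U V (β_ U U).hom = 𝟙 U := by
  have h := BraidedCategory.braiding_naturality_right U (η_ U V)
  rw [BraidedCategory.braiding_tensor_right_hom, braiding_tensorUnit_right] at h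
  have h' := congrArg (fun t => (ρ_ U).inv ≫ t ≫ (α_ _ _ _).hom ≫ U ◁ ε_ U V ≫ (ρ_ U).hom) h
  simp at h'
  simpa [pairingTrace, evTilde] using h'

lemma pairingTrace_id (A U V : C) [ExactPairing U V] :
    pairingTrace A A U V (𝟙 _) = (ρ_ A).inv ≫ A ◁ (η_ U V ≫ evTilde U V) ≫ (ρ_ A).hom := by
  simp [pairingTrace]

lemma pairingTrace_id_unit (A : C) : pairingTrace A A (𝟙_ C) (𝟙_ C) (𝟙 _) = 𝟙 A := by
  have : η_ (𝟙_ C) (𝟙_ C) ≫ evTilde (𝟙_ C) (𝟙_ C) = 𝟙 _ := by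
    have h1 : η_ (𝟙_ C) (𝟙_ C) = (ρ_ _).inv := rfl
    have h2 : ε_ (𝟙_ C) (𝟙_ C) = (λ_ _).hom := unitors_equal.symm
    rw [evTilde, h1, h2, braiding_leftUnitor, Iso.inv_hom_id]
  simp [pairingTrace_id, this]

lemma pairingTrace_smul {k : Type*} [Field k] [Preadditive C] [Linear k C]
    [MonoidalPreadditive C] [MonoidalLinear k C] (c : k) {A B U V : C} [ExactPairing U V]
    (f : A ⊗ U ⟶ B ⊗ U) :
    pairingTrace A B U V (c • f) = c • pairingTrace A B U V f := by
  simp [pairingTrace]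

end Trace

section BlockCycleWord

/-- The transposition of `i` and `i + 1` in `Perm (Fin m)`, or `1` when out of range. -/
def finAdjSwap (m i : ℕ) : Equiv.Perm (Fin m) :=
  if h : i + 1 < m then Equiv.swap ⟨i, Nat.lt_of_succ_lt h⟩ ⟨i + 1, h⟩ else 1

/-- The permutation spelled by a word in the adjacent transpositions. -/
def wordPerm (m : ℕ) (w : List ℕ) : Equiv.Perm (Fin m) := (w.map (finAdjSwap m)).prod

/-- A word in the adjacent transpositions spelling the block cycle permutation of a list
of positive block sizes. -/
def blockCycleWord : List ℕ → List ℕ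
  | [] => []
  | 0 :: rest => blockCycleWord rest
  | 1 :: rest => (blockCycleWord rest).map Nat.succ
  | (a + 2) :: rest => 0 :: (blockCycleWord ((a + 1) :: rest)).map Nat.succ
termination_by l => l.sum + l.length

/-- The block cycle permutation as a function on natural numbers. -/
def blockCycleFun : List ℕ → ℕ → ℕ
  | [], x => x
  | a :: rest, x =>
    if x < a then (if x + 1 = a then 0 else x + 1) else a + blockCycleFun rest (x - a)

lemma val_permCongr_sumCongr {a n s : ℕ} (h : a + n = s) (σ : Equiv.Perm (Fin a))
    (τ : Equiv.Perm (Fin n)) (x : Fin s) :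
    (((finSumFinEquiv.trans (finCongr h)).permCongr (Equiv.sumCongr σ τ)) x : ℕ) =
      if hx : (x : ℕ) < a then (σ ⟨x, hx⟩ : ℕ) else a + τ ⟨x - a, by omega⟩ := by
  subst h
  obtain ⟨y | y, rfl⟩ := finSumFinEquiv.surjective x
  · simp [Equiv.permCongr_apply]
  · simp [Equiv.permCongr_apply]

lemma val_blockCyclePerm (l : List ℕ) (x : Fin l.sum) :
    (blockCyclePerm l x : ℕ) = blockCycleFun l x := by
  induction l with
  | nil => rfl
  | cons a rest ih =>
    refine (val_permCongr_sumCongr (s := (a :: rest).sum) (by simp) (finRotate a)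
      (blockCyclePerm rest) x).trans ?_
    rw [blockCycleFun]
    split_ifs with h h'
    · obtain ⟨b, rfl⟩ : ∃ b, a = b + 1 := ⟨x, h'.symm⟩
      have hx : (⟨x, h⟩ : Fin (b + 1)) = Fin.last b := Fin.ext (by simpa using h')
      simp [hx]
    · obtain ⟨b, rfl⟩ := Nat.exists_eq_succ_of_ne_zero (Nat.ne_zero_of_lt h)
      rw [coe_finRotate_of_ne_last]
      simpa [Fin.ext_iff] using h'
    · rw [ih]

lemma finAdjSwap_succ_succ (m i : ℕ) (x : Fin m) :
    finAdjSwap (m + 1) (i + 1) x.succ = (finAdjSwap m i x).succ := by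
  by_cases h : i + 1 < m
  · have h' : i + 1 + 1 < m + 1 := by omega
    simp only [finAdjSwap, h, h', dif_pos]
    exact ((Fin.succ_injective m).swap_apply ⟨i, by omega⟩ ⟨i + 1, h⟩ x)
  · have h' : ¬ i + 1 + 1 < m + 1 := by omega
    simp only [finAdjSwap, h, h', dif_neg, not_false_iff, Equiv.Perm.one_apply]

lemma finAdjSwap_succ_zero (m i : ℕ) : finAdjSwap (m + 1) (i + 1) 0 = 0 := by
  by_cases h : i + 1 + 1 < m + 1
  · simp only [finAdjSwap, h, dif_pos]
    exact Equiv.swap_apply_of_ne_of_ne (by simp [Fin.ext_iff]) (by simp [Fin.ext_iff])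
  · simp [finAdjSwap, h]

lemma wordPerm_map_succ_succ (m : ℕ) (w : List ℕ) (x : Fin m) :
    wordPerm (m + 1) (w.map Nat.succ) x.succ = (wordPerm m w x).succ := by
  induction w with
  | nil => rfl
  | cons i w ih =>
    simp only [wordPerm, List.map_cons, List.prod_cons, Equiv.Perm.mul_apply] at ih ⊢
    rw [ih, Nat.succ_eq_add_one, finAdjSwap_succ_succ]

lemma wordPerm_map_succ_zero (m : ℕ) (w : List ℕ) :
    wordPerm (m + 1) (w.map Nat.succ) 0 = 0 := by
  induction w with
  | nil => rfl
  | cons i w ih =>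
    simp only [wordPerm, List.map_cons, List.prod_cons, Equiv.Perm.mul_apply] at ih ⊢
    rw [ih, Nat.succ_eq_add_one, finAdjSwap_succ_zero]

lemma val_finAdjSwap_zero (m : ℕ) (x : Fin (m + 2)) :
    (finAdjSwap (m + 2) 0 x : ℕ) =
      if (x : ℕ) = 0 then (1 : ℕ) else if (x : ℕ) = 1 then (0 : ℕ) else (x : ℕ) := by
  simp only [finAdjSwap, Nat.zero_add, Nat.lt_add_left_iff_pos, Nat.zero_lt_succ, dif_pos,
    Equiv.swap_apply_def, Fin.ext_iff]
  split_ifs <;> simp_all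

lemma val_wordPerm_blockCycleWord (l : List ℕ) (m : ℕ) (hl : l.sum = m) (x : Fin m) :
    (wordPerm m (blockCycleWord l) x : ℕ) = blockCycleFun l x := by
  induction l using blockCycleWord.induct generalizing m with
  | case1 => simp [blockCycleWord, wordPerm, blockCycleFun]
  | case2 rest ih =>
    simpa [blockCycleWord, blockCycleFun] using ih m (by simpa using hl) x
  | case3 rest ih =>
    obtain ⟨n, rfl⟩ : ∃ n, m = n + 1 := ⟨rest.sum, by simp at hl; omega⟩
    rw [blockCycleWord]
    refine Fin.cases ?_ (fun y => ?_) x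
    · simp [wordPerm_map_succ_zero, blockCycleFun]
    · rw [wordPerm_map_succ_succ, Fin.val_succ, ih n (by simp at hl; omega)]
      simp [blockCycleFun, Nat.add_comm]
  | case4 a rest ih =>
    obtain ⟨n, rfl⟩ : ∃ n, m = n + 2 := ⟨a + rest.sum, by simp at hl; omega⟩
    have hcons : ∀ w, wordPerm (n + 2) (0 :: w) x = finAdjSwap (n + 2) 0 (wordPerm (n + 2) w x) :=
      fun w => by simp [wordPerm]
    rw [blockCycleWord, hcons, val_finAdjSwap_zero]
    refine Fin.cases ?_ (fun y => ?_) x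
    · simp [wordPerm_map_succ_zero, blockCycleFun]
    · rw [wordPerm_map_succ_succ, Fin.val_succ, ih (n + 1) (by simp at hl ⊢; omega)]
      simp only [blockCycleFun, Fin.val_succ]
      have e : (y : ℕ) + 1 - (a + 2) = y - (a + 1) := by omega
      rw [e]
      split_ifs <;> first | contradiction | omega

lemma permCongr_blockCyclePerm (l : List ℕ) (m : ℕ) (hl : l.sum = m) :
    (finCongr hl).permCongr (blockCyclePerm l) = wordPerm m (blockCycleWord l) := by
  ext x
  rw [val_wordPerm_blockCycleWord l m hl]
  simp [Equiv.permCongr_apply, val_blockCyclePerm]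

/-- The endomorphism of `X^{⊗m}` spelled by a word in the adjacent braidings. -/
def wordHom [BraidedCategory C] (X : C) (m : ℕ) (w : List ℕ) :
    CategoryTheory.End (tpow X m) :=
  (List.map (β := CategoryTheory.End (tpow X m)) (adjSwap X m) w).prod

lemma adjSwap_of_le [BraidedCategory C] (X : C) (m i : ℕ) (h : m ≤ i + 1) :
    adjSwap X m i = 𝟙 _ := by
  induction m, i using adjSwap.induct with
  | case1 => rfl
  | case2 => rfl
  | case3 => omega
  | case4 m i ih =>
    rw [adjSwap, ih (by omega)]
    exact MonoidalCategory.whiskerLeft_id _ _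

lemma IsPermAction.map_wordPerm [BraidedCategory C] {X : C} {m : ℕ}
    {ρ : Equiv.Perm (Fin m) →* CategoryTheory.End (tpow X m)} (hρ : IsPermAction X m ρ)
    (w : List ℕ) : ρ (wordPerm m w) = wordHom X m w := by
  rw [wordPerm, wordHom, map_list_prod, List.map_map]
  congr 1
  refine List.map_congr_left fun i _ => ?_
  by_cases h : i + 1 < m
  · simpa [finAdjSwap, h] using hρ i h
  · simp only [Function.comp, finAdjSwap, h, dif_neg, not_false_iff, map_one]
    exact (adjSwap_of_le X m i (by omega)).symm

lemma wordHom_cons [BraidedCategory C] (X : C) (m i : ℕ) (w : List ℕ) :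
    wordHom X m (i :: w) = wordHom X m w ≫ adjSwap X m i := by
  rw [wordHom, List.map_cons, List.prod_cons]
  rfl

lemma wordHom_map_succ [BraidedCategory C] (X : C) (m : ℕ) (w : List ℕ) :
    wordHom X (m + 2) (w.map Nat.succ) = X ◁ wordHom X (m + 1) w := by
  induction w with
  | nil => exact (MonoidalCategory.whiskerLeft_id _ _).symm
  | cons i w ih =>
    rw [List.map_cons, wordHom_cons, wordHom_cons, ih, MonoidalCategory.whiskerLeft_comp]
    rfl

end BlockCycleWord

section

variable [SymmetricCategory C] [RigidCategory C]

lemma ptrace_tensor {A B U W : C} (f : A ⊗ (U ⊗ W) ⟶ B ⊗ (U ⊗ W)) :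
    ptrace A B (U ⊗ W) f =
      ptrace A B U (ptrace (A ⊗ U) (B ⊗ U) W ((α_ A U W).hom ≫ f ≫ (α_ B U W).inv)) := by
  rw [ptrace_eq_pairingTrace,
    pairingTrace_congr _ (ExactPairing.tensor (Y₁ := Uᘁ) (Y₂ := Wᘁ)), pairingTrace_tensor]
  rfl

lemma ptrace_whiskerLeft (X U : C) (g : X ⊗ U ⟶ X ⊗ U) :
    ptrace X X (X ⊗ U) (X ◁ g) =
      pairingTrace X X X (Xᘁ) (X ◁ ptrace X X U g) := by
  rw [ptrace_tensor, ptrace_eq_pairingTrace, ptrace_eq_pairingTrace, ptrace_eq_pairingTrace,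
    pairingTrace_whiskerLeft]

lemma ptrace_whiskerLeft_comp_braiding (X U : C) (g : X ⊗ U ⟶ X ⊗ U) :
    ptrace X X (X ⊗ U)
        (X ◁ g ≫ (α_ X X U).inv ≫ ((β_ X X).hom ▷ U) ≫ (α_ X X U).hom) =
      pairingTrace X X X (Xᘁ) (X ◁ ptrace X X U g ≫ (β_ X X).hom) := by
  rw [ptrace_tensor, ptrace_eq_pairingTrace, ptrace_eq_pairingTrace, ptrace_eq_pairingTrace,
    ← pairingTrace_whiskerLeft, ← pairingTrace_comp]
  simp only [Category.assoc, Iso.hom_inv_id, Category.comp_id]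

lemma ptrace_id_unit (X : C) : ptrace X X (𝟙_ C) (𝟙 (X ⊗ 𝟙_ C)) = 𝟙 X := by
  rw [ptrace_eq_pairingTrace, pairingTrace_congr _ exactPairingUnit, pairingTrace_id_unit]

variable {k : Type*} [Field k] [Preadditive C] [Linear k C]
    [MonoidalPreadditive C] [MonoidalLinear k C]

lemma ptrace_wordHom_blockCycleWord (X : C) (d : k)
    (hd : η_ X (Xᘁ) ≫ (β_ X (Xᘁ)).hom ≫ ε_ X (Xᘁ) = d • 𝟙 (𝟙_ C))
    (l : List ℕ) (hpos : ∀ a ∈ l, 0 < a) (m : ℕ) (hl : l.sum = m + 1) :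
    ptrace X X (tpow X m) (wordHom X (m + 1) (blockCycleWord l)) =
      d ^ (l.length - 1) • 𝟙 X := by
  induction l using blockCycleWord.induct generalizing m with
  | case1 => simp at hl
  | case2 => simp at hpos
  | case3 rest ih =>
    rw [blockCycleWord]
    cases m with
    | zero =>
      cases rest with
      | nil =>
        simp only [blockCycleWord, List.length_singleton, Nat.sub_self, pow_zero, one_smul]
        exact ptrace_id_unit X
      | cons b rest =>
        have := hpos b (by simp)
        simp at hl
        omega
    | succ m =>
      have hl' : rest.sum = m + 1 := by simp at hl; omega
      have hne : rest ≠ [] := by rintro rfl; simp at hl'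
      obtain ⟨n, hn⟩ : ∃ n, rest.length = n + 1 :=
        Nat.exists_eq_succ_of_ne_zero (by simpa using hne)
      rw [wordHom_map_succ]
      refine (ptrace_whiskerLeft X (tpow X m) _).trans ?_
      rw [ih (fun a ha => hpos a (by simp [ha])) m hl', MonoidalLinear.whiskerLeft_smul,
        pairingTrace_smul, MonoidalCategory.whiskerLeft_id, pairingTrace_id, evTilde, hd,
        MonoidalLinear.whiskerLeft_smul]
      simp [hn, pow_succ, smul_smul]
  | case4 a rest ih =>
    obtain ⟨n, rfl⟩ : ∃ n, m = n + 1 := ⟨a + rest.sum, by simp at hl; omega⟩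
    rw [blockCycleWord, wordHom_cons, wordHom_map_succ]
    refine (ptrace_whiskerLeft_comp_braiding X (tpow X n) _).trans ?_
    rw [ih (by simp at hpos ⊢; exact hpos) n (by simp at hl ⊢; omega),
      MonoidalLinear.whiskerLeft_smul, Linear.smul_comp, pairingTrace_smul,
      MonoidalCategory.whiskerLeft_id, Category.id_comp, pairingTrace_braiding]
    simp

end

/-- Let `C` be a `k`-linear symmetric rigid monoidal category with
`End (𝟙_ C) = k`, let `X : C` have dimension `d = ẽv_X ∘ coev_X ∈ k`, and view
`X^{⊗(m+1)}` as `X ⊗ X^{⊗m}`.  Let `σ ∈ S_{m+1}` be a product of `N` disjoint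
cycles whose supports are consecutive blocks arranged in increasing order (encoded by a
list `l` of `N` positive block sizes with sum `m+1`).  Then for the action `ρ` of
`S_{m+1}` on `X^{⊗(m+1)}` permuting the tensor factors via the symmetry,
`Tr^{X^{⊗m}}_{X,X}(ρ σ) = d^{N-1} • id_X`. -/
theorem ptrace_blockCycles
    {k : Type*} [Field k] [Preadditive C] [Linear k C]
    [MonoidalPreadditive C] [MonoidalLinear k C]
    [SymmetricCategory C] [RigidCategory C]
    (hEnd : Function.Bijective (fun a : k => a • (𝟙 (𝟙_ C))))
    (X : C) (d : k)
    (hd : η_ X (Xᘁ) ≫ (β_ X (Xᘁ)).hom ≫ ε_ X (Xᘁ) = d • 𝟙 (𝟙_ C))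
    (m : ℕ)
    (ρ : Equiv.Perm (Fin (m + 1)) →* CategoryTheory.End (tpow X (m + 1)))
    (hρ : IsPermAction X (m + 1) ρ)
    (l : List ℕ) (hpos : ∀ a ∈ l, 0 < a) (hl : l.sum = m + 1) :
    ptrace X X (tpow X m) (ρ ((finCongr hl).permCongr (blockCyclePerm l))) =
      d ^ (l.length - 1) • 𝟙 X := by
  rw [permCongr_blockCyclePerm, hρ.map_wordPerm]
  exact ptrace_wordHom_blockCycleWord X d hd l hpos m hl
end

section
/- Let G be a group, let n ≥ 1, and let k be a field with char(k) = 0 or char(k) > n. Let V be a finite-dimensional representation of G over k. If the n-th symmetric power SymⁿV (with its induced G-action) is a semisimple representation and the image of dim_k V in k is not equal to the image of any of the integers −n, −(n−1), …, −2, then V is a semisimple representation. -/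
open scoped TensorProduct

/-- The subspace of the `n`-th tensor power `V^{⊗n}` spanned by the differences
`v₁ ⊗ ⋯ ⊗ vₙ - v_{σ(1)} ⊗ ⋯ ⊗ v_{σ(n)}` over all permutations `σ`. -/
def symRelations (k V : Type*) [Field k] [AddCommGroup V] [Module k V] (n : ℕ) :
    Submodule k (⨂[k]^n V) :=
  Submodule.span k {x | ∃ (σ : Equiv.Perm (Fin n)) (v : Fin n → V),
    x = (PiTensorProduct.tprod k) v - (PiTensorProduct.tprod k) (v ∘ σ)}

/-- The `n`-th symmetric power `Symⁿ V` of `V`: the quotient of the `n`-th tensor power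
by the symmetrization relations. -/
abbrev SymPow (k V : Type*) [Field k] [AddCommGroup V] [Module k V] (n : ℕ) :=
  (⨂[k]^n V) ⧸ symRelations k V n

/-- The linear map `Symⁿ V → Symⁿ V` induced functorially by `f : V → V`. -/
noncomputable def symPowMapAux {k V : Type*} [Field k] [AddCommGroup V] [Module k V]
    (n : ℕ) (f : V →ₗ[k] V) : SymPow k V n →ₗ[k] SymPow k V n :=
  Submodule.mapQ _ _ (PiTensorProduct.map fun _ : Fin n => f) (by
    conv_lhs => rw [symRelations]
    rw [Submodule.span_le]
    rintro x ⟨σ, v, rfl⟩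
    simp only [SetLike.mem_coe, Submodule.mem_comap, map_sub, PiTensorProduct.map_tprod]
    exact Submodule.subset_span ⟨σ, fun i => f (v i), rfl⟩)

/-- The representation of `G` on the `n`-th symmetric power `Symⁿ V` induced
functorially by a representation `ρ` of `G` on `V`. -/
noncomputable def symPowRep {k G V : Type*} [Field k] [Group G] [AddCommGroup V]
    [Module k V] (ρ : Representation k G V) (n : ℕ) :
    Representation k G (SymPow k V n) where
  toFun g := symPowMapAux n (ρ g)
  map_one' := by
    refine Submodule.linearMap_qext _ ?_
    refine PiTensorProduct.ext ?_
    ext v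
    simp [symPowMapAux, map_one]
  map_mul' g h := by
    refine Submodule.linearMap_qext _ ?_
    refine PiTensorProduct.ext ?_
    ext v
    simp [symPowMapAux, map_mul]

section PolynomialOperators

open MvPolynomial

/-- The linear substitution `X j ↦ ∑ i, M i j • X i` of polynomials given by a square matrix. -/
noncomputable def matrixSubst {k ι : Type*} [CommRing k] [Fintype ι] (M : Matrix ι ι k) :
    MvPolynomial ι k →ₐ[k] MvPolynomial ι k :=
  aeval fun j => ∑ i, M i j • X i

/-- The ideal generated by the first block of variables. -/
noncomputable def leftIdeal (k α β : Type*) [CommRing k] : Ideal (MvPolynomial (α ⊕ β) k) :=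
  Ideal.span (Set.range fun e : α => X (Sum.inl e))

variable {k : Type*} [CommRing k]

@[simp]
lemma matrixSubst_X {ι : Type*} [Fintype ι] (M : Matrix ι ι k) (j : ι) :
    matrixSubst M (X j) = ∑ i, M i j • X i := by
  simp [matrixSubst]

lemma matrixSubst_isHomogeneous {ι : Type*} [Fintype ι] (M : Matrix ι ι k)
    {p : MvPolynomial ι k} {d : ℕ} (hp : p.IsHomogeneous d) :
    (matrixSubst M p).IsHomogeneous d := by
  have h := hp.aeval (fun j => ∑ i, M i j • (X i : MvPolynomial ι k)) (n := 1) (fun j => by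
    refine IsHomogeneous.sum _ _ _ fun i _ => ?_
    rw [smul_eq_C_mul]
    exact (isHomogeneous_X k i).C_mul _)
  simpa [matrixSubst] using h

lemma constantCoeff_matrixSubst {ι : Type*} [Fintype ι] (M : Matrix ι ι k)
    (p : MvPolynomial ι k) : constantCoeff (matrixSubst M p) = constantCoeff p := by
  induction p using MvPolynomial.induction_on with
  | C a => simp [matrixSubst]
  | add p q hp hq => simp [hp, hq]
  | mul_X p i _ => simp [constantCoeff_smul]

lemma pderiv_matrixSubst {ι : Type*} [Fintype ι] (M : Matrix ι ι k) (i : ι)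
    (p : MvPolynomial ι k) :
    pderiv i (matrixSubst M p) = ∑ j, M i j • matrixSubst M (pderiv j p) := by
  classical
  induction p using MvPolynomial.induction_on with
  | C a => simp [matrixSubst, algebraMap_eq]
  | add p q hp hq => simp [hp, hq, smul_add, Finset.sum_add_distrib]
  | mul_X p l hp =>
    simp only [map_mul, Derivation.leibniz, hp, map_add, smul_eq_mul, smul_add,
      Finset.sum_add_distrib, matrixSubst_X, map_sum, Derivation.map_smul, pderiv_X]
    congr 1
    · rw [Finset.sum_eq_single i (fun b _ hb => by simp [hb.symm]) (by simp),
        Finset.sum_eq_single l (fun b _ hb => by simp [hb.symm]) (by simp)]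
      simp
    · rw [Finset.mul_sum]
      simp

/-- Induction along the powers of an ideal given by generators. -/
lemma span_range_pow_induction {R σ : Type*} [CommRing R] (x : σ → R) (P : ℕ → R → Prop)
    (zero_pow : ∀ r, P 0 r) (zero : ∀ i, P i 0) (add : ∀ i p q, P i p → P i q → P i (p + q))
    (mul : ∀ i e p, p ∈ Ideal.span (Set.range x) ^ i → P i p → P (i + 1) (x e * p))
    (i : ℕ) {q : R} (hq : q ∈ Ideal.span (Set.range x) ^ i) : P i q := by
  induction i generalizing q with
  | zero => exact zero_pow q
  | succ i ih =>
    rw [pow_succ'] at hq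
    refine Submodule.mul_induction_on hq (fun m hm p hp => ?_) (fun p q => add _ p q)
    clear hq
    induction hm using Submodule.span_induction generalizing p with
    | mem m h =>
      obtain ⟨e, rfl⟩ := h
      exact mul i e p hp (ih hp)
    | zero => simpa using zero _
    | add a b _ _ ha hb => rw [add_mul]; exact add _ _ _ (ha p hp) (hb p hp)
    | smul r a _ ha =>
      rw [smul_eq_mul, mul_right_comm, mul_comm, mul_comm r p]
      simpa [mul_comm] using ha (r * p) (Ideal.mul_mem_left _ _ hp)

variable {α β : Type*}

lemma X_inl_mem (e : α) : (X (Sum.inl e) : MvPolynomial (α ⊕ β) k) ∈ leftIdeal k α β :=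
  Ideal.subset_span ⟨e, rfl⟩

lemma smul_mem_leftIdeal_pow {i : ℕ} (c : k) {q : MvPolynomial (α ⊕ β) k}
    (hq : q ∈ leftIdeal k α β ^ i) : c • q ∈ leftIdeal k α β ^ i := by
  rw [smul_eq_C_mul]
  exact Ideal.mul_mem_left _ _ hq

lemma X_inl_mul_mem {i : ℕ} (e : α) {q : MvPolynomial (α ⊕ β) k}
    (hq : q ∈ leftIdeal k α β ^ i) : X (Sum.inl e) * q ∈ leftIdeal k α β ^ (i + 1) := by
  rw [pow_succ']
  exact Ideal.mul_mem_mul (X_inl_mem e) hq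

lemma constantCoeff_eq_zero_of_mem_leftIdeal {q : MvPolynomial (α ⊕ β) k}
    (hq : q ∈ leftIdeal k α β) : constantCoeff q = 0 := by
  have : leftIdeal k α β ≤ RingHom.ker (constantCoeff (σ := α ⊕ β) (R := k)) := by
    rw [leftIdeal, Ideal.span_le]
    rintro _ ⟨e, rfl⟩
    simp
  exact this hq

lemma pderiv_inl_mem (e : α) {i : ℕ} {q : MvPolynomial (α ⊕ β) k}
    (hq : q ∈ leftIdeal k α β ^ (i + 1)) : pderiv (Sum.inl e) q ∈ leftIdeal k α β ^ i := by
  suffices ∀ j, ∀ q ∈ leftIdeal k α β ^ j, pderiv (Sum.inl e) q ∈ leftIdeal k α β ^ (j - 1) from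
    this (i + 1) q hq
  intro j q hq
  refine span_range_pow_induction _ (fun j q => pderiv (Sum.inl e) q ∈ leftIdeal k α β ^ (j - 1))
    (by simp) (by simp) (fun j p q hp hq => ?_) (fun j f p hp h => ?_) j hq
  · rw [map_add]; exact Ideal.add_mem _ hp hq
  · rw [Derivation.leibniz]
    refine Ideal.add_mem _ ?_ (by rw [smul_eq_mul]; exact Ideal.mul_mem_right _ _ hp)
    cases j with
    | zero => simp
    | succ j => exact X_inl_mul_mem _ h

lemma pderiv_inr_mem (f : β) {i : ℕ} {q : MvPolynomial (α ⊕ β) k}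
    (hq : q ∈ leftIdeal k α β ^ i) : pderiv (Sum.inr f) q ∈ leftIdeal k α β ^ i := by
  classical
  refine span_range_pow_induction _ (fun j q => pderiv (Sum.inr f) q ∈ leftIdeal k α β ^ j)
    (by simp) (by simp) (fun j p q hp hq => ?_) (fun j e p hp h => ?_) i hq
  · rw [map_add]; exact Ideal.add_mem _ hp hq
  · rw [Derivation.leibniz, pderiv_X_of_ne (by simp), smul_zero, add_zero]
    exact X_inl_mul_mem _ h

variable [Fintype α]

lemma sum_X_inl_mul_pderiv_sub_mem {i : ℕ} {q : MvPolynomial (α ⊕ β) k}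
    (hq : q ∈ leftIdeal k α β ^ i) :
    ∑ e : α, X (Sum.inl e) * pderiv (Sum.inl e) q - (i : k) • q ∈ leftIdeal k α β ^ (i + 1) := by
  classical
  refine span_range_pow_induction _ (fun j q =>
    ∑ e : α, X (Sum.inl e) * pderiv (Sum.inl e) q - (j : k) • q ∈ leftIdeal k α β ^ (j + 1))
    (fun r => ?_) (by simp) (fun j p q hp hq => ?_) (fun j e p hp h => ?_) i hq
  · simp only [Nat.cast_zero, zero_smul, sub_zero, zero_add, pow_one]
    exact Ideal.sum_mem _ fun e _ => Ideal.mul_mem_right _ _ (X_inl_mem e)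
  · convert Ideal.add_mem _ hp hq using 1
    simp only [map_add, mul_add, smul_add, Finset.sum_add_distrib]
    abel
  · convert X_inl_mul_mem e h using 1
    simp only [Derivation.leibniz, smul_eq_mul, mul_add, Finset.sum_add_distrib, pderiv_X]
    rw [Finset.sum_eq_single (s := Finset.univ) (a := e)
      (f := fun x => X (Sum.inl x) * (p * _))
      (fun b _ hb => by simp [hb.symm]) (by simp)]
    simp only [Pi.single_eq_same, mul_sub, Finset.mul_sum, Nat.cast_add, Nat.cast_one, add_smul,
      one_smul, mul_smul_comm, mul_one, mul_left_comm (X (Sum.inl e))]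
    abel

lemma sum_pderiv_X_inl_mul_sub_mem {i : ℕ} {q : MvPolynomial (α ⊕ β) k}
    (hq : q ∈ leftIdeal k α β ^ i) :
    ∑ e : α, pderiv (Sum.inl e) (X (Sum.inl e) * q) - ((Fintype.card α : k) + i) • q ∈
      leftIdeal k α β ^ (i + 1) := by
  convert sum_X_inl_mul_pderiv_sub_mem hq using 1
  simp [Derivation.leibniz, Finset.sum_add_distrib, add_smul, Nat.cast_smul_eq_nsmul]
  abel

variable [Fintype β]

lemma sum_pderiv_X_inr_mul_sub_mem {i m : ℕ} {q : MvPolynomial (α ⊕ β) k}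
    (hq : q ∈ leftIdeal k α β ^ i) (hq' : q.IsHomogeneous (i + m)) :
    ∑ f : β, pderiv (Sum.inr f) (X (Sum.inr f) * q) - ((Fintype.card β : k) + m) • q ∈
      leftIdeal k α β ^ (i + 1) := by
  have h := hq'.sum_X_mul_pderiv
  rw [Fintype.sum_sum_type] at h
  convert Ideal.neg_mem_iff _ |>.2 (sum_X_inl_mul_pderiv_sub_mem hq) using 1
  rw [← eq_sub_iff_add_eq'] at h
  simp [Derivation.leibniz, Finset.sum_add_distrib, add_smul, Nat.cast_smul_eq_nsmul, h]
  abel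

lemma matrixSubst_fromBlocks_X_inl (LA : Matrix α α k) (C : Matrix α β k) (LB : Matrix β β k)
    (e : α) : matrixSubst (Matrix.fromBlocks LA C 0 LB) (X (Sum.inl e)) =
      ∑ e', LA e' e • X (Sum.inl e') := by
  simp [Fintype.sum_sum_type]

lemma matrixSubst_fromBlocks_X_inr (LA : Matrix α α k) (C : Matrix α β k) (LB : Matrix β β k)
    (f : β) : matrixSubst (Matrix.fromBlocks LA C 0 LB) (X (Sum.inr f)) =
      ∑ e, C e f • X (Sum.inl e) + ∑ f', LB f' f • X (Sum.inr f') := by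
  simp [Fintype.sum_sum_type]

omit [Fintype β] in
lemma sum_smul_X_inl_mem (c : α → k) :
    ∑ e, c e • (X (Sum.inl e) : MvPolynomial (α ⊕ β) k) ∈ leftIdeal k α β :=
  Ideal.sum_mem _ fun e _ => by
    simpa using smul_mem_leftIdeal_pow (i := 1) (c e) (by simpa using X_inl_mem e)

lemma matrixSubst_fromBlocks_mem (LA : Matrix α α k) (C : Matrix α β k) (LB : Matrix β β k)
    {i : ℕ} {q : MvPolynomial (α ⊕ β) k} (hq : q ∈ leftIdeal k α β ^ i) :
    matrixSubst (Matrix.fromBlocks LA C 0 LB) q ∈ leftIdeal k α β ^ i := by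
  refine span_range_pow_induction _
    (fun i q => matrixSubst (Matrix.fromBlocks LA C 0 LB) q ∈ leftIdeal k α β ^ i)
    (by simp) (by simp) (fun i p q hp hq => ?_) (fun i e p _ hp => ?_) i hq
  · rw [map_add]
    exact Ideal.add_mem _ hp hq
  · rw [map_mul, matrixSubst_fromBlocks_X_inl, pow_succ']
    exact Ideal.mul_mem_mul (sum_smul_X_inl_mem _) hp

lemma matrixSubst_sub_mem (LA : Matrix α α k) (C : Matrix α β k) (LB : Matrix β β k)
    {i : ℕ} {q : MvPolynomial (α ⊕ β) k} (hq : q ∈ leftIdeal k α β ^ i) :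
    matrixSubst (Matrix.fromBlocks LA C 0 LB) q - matrixSubst (Matrix.fromBlocks LA 0 0 LB) q ∈
      leftIdeal k α β ^ (i + 1) := by
  refine span_range_pow_induction _ (fun i q =>
    matrixSubst (Matrix.fromBlocks LA C 0 LB) q - matrixSubst (Matrix.fromBlocks LA 0 0 LB) q ∈
      leftIdeal k α β ^ (i + 1)) (fun r => ?_) (by simp) (fun i p q hp hq => ?_)
      (fun i e p _ hp => ?_) i hq
  · rw [zero_add, pow_one]
    induction r using MvPolynomial.induction_on with
    | C a => simp [matrixSubst]
    | add p q hp hq =>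
      rw [map_add, map_add, add_sub_add_comm]
      exact Ideal.add_mem _ hp hq
    | mul_X p j hp =>
      rw [map_mul, map_mul, ← sub_add_sub_cancel _ (matrixSubst (Matrix.fromBlocks LA 0 0 LB) p *
        matrixSubst (Matrix.fromBlocks LA C 0 LB) (X j)), ← sub_mul, ← mul_sub]
      refine Ideal.add_mem _ (Ideal.mul_mem_right _ _ hp) (Ideal.mul_mem_left _ _ ?_)
      cases j with
      | inl e => simp only [matrixSubst_fromBlocks_X_inl, sub_self, zero_mem]
      | inr f =>
        simp only [matrixSubst_fromBlocks_X_inr, add_sub_add_right_eq_sub]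
        simpa using sum_smul_X_inl_mem _
  · rw [map_add, map_add, add_sub_add_comm]
    exact Ideal.add_mem _ hp hq
  · rw [map_mul, map_mul, matrixSubst_fromBlocks_X_inl, matrixSubst_fromBlocks_X_inl, ← mul_sub,
      pow_succ' _ (i + 1)]
    exact Ideal.mul_mem_mul (sum_smul_X_inl_mem _) hp

omit [Fintype α] in
/-- The first-order expansion of a triangular substitution `g` around its diagonal part `l`. -/
lemma map_sub_sub_sum_mem {g l : MvPolynomial (α ⊕ β) k →ₐ[k] MvPolynomial (α ⊕ β) k}
    {c : β → MvPolynomial (α ⊕ β) k} (hc : ∀ f, c f ∈ leftIdeal k α β)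
    (hgl : ∀ p, g p - l p ∈ leftIdeal k α β)
    (hl : ∀ e, l (X (Sum.inl e)) ∈ leftIdeal k α β)
    (hinl : ∀ e, g (X (Sum.inl e)) = l (X (Sum.inl e)))
    (hinr : ∀ f, g (X (Sum.inr f)) = c f + l (X (Sum.inr f)))
    {i : ℕ} {q : MvPolynomial (α ⊕ β) k} (hq : q ∈ leftIdeal k α β ^ i) :
    g q - l q - ∑ f, c f * l (pderiv (Sum.inr f) q) ∈ leftIdeal k α β ^ (i + 2) := by
  classical
  refine span_range_pow_induction _ (fun i q =>
    g q - l q - ∑ f, c f * l (pderiv (Sum.inr f) q) ∈ leftIdeal k α β ^ (i + 2))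
    (fun r => ?_) (by simp) (fun i p q hp hq => ?_) (fun i e p _ hp => ?_) i hq
  · rw [zero_add]
    induction r using MvPolynomial.induction_on with
    | C a =>
      have h (φ : MvPolynomial (α ⊕ β) k →ₐ[k] MvPolynomial (α ⊕ β) k) : φ (C a) = C a :=
        φ.commutes a
      simp [h]
    | add p q hp hq =>
      convert Ideal.add_mem _ hp hq using 1
      simp only [map_add, mul_add, Finset.sum_add_distrib]
      ring
    | mul_X p j hp =>
      cases j with
      | inl e =>
        convert Ideal.mul_mem_right (l (X (Sum.inl e))) _ hp using 1
        rw [sub_mul, sub_mul, Finset.sum_mul, map_mul, map_mul, hinl]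
        congr 1
        refine Finset.sum_congr rfl fun f _ => ?_
        rw [Derivation.leibniz, pderiv_X_of_ne (by simp), smul_zero, zero_add, smul_eq_mul,
          map_mul]
        ring
      | inr f =>
        have h1 := Ideal.mul_mem_right (l (X (Sum.inr f))) _ hp
        have h2 := Ideal.mul_mem_mul (hgl p) (hc f)
        rw [← pow_two] at h2
        have h3 : ∑ f', c f' * l (pderiv (Sum.inr f') (p * X (Sum.inr f))) =
            c f * l p + (∑ f', c f' * l (pderiv (Sum.inr f') p)) * l (X (Sum.inr f)) := by
          simp only [Derivation.leibniz, map_add, smul_eq_mul, mul_add, Finset.sum_add_distrib,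
            pderiv_X, map_mul, Finset.sum_mul]
          congr 1
          · rw [Finset.sum_eq_single f (fun b _ hb => by simp [hb.symm]) (by simp)]
            simp
          · exact Finset.sum_congr rfl fun f' _ => by ring
        convert Ideal.add_mem _ h1 h2 using 1
        rw [h3, map_mul, map_mul, hinr]
        ring
  · convert Ideal.add_mem _ hp hq using 1
    simp only [map_add, mul_add, Finset.sum_add_distrib]
    ring
  · have h := Ideal.mul_mem_mul (hl e) hp
    rw [← pow_succ'] at h
    convert h using 1
    rw [mul_sub, mul_sub, Finset.mul_sum, map_mul, map_mul, hinl]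
    congr 1
    refine Finset.sum_congr rfl fun f _ => ?_
    rw [Derivation.leibniz, pderiv_X_of_ne (by simp), smul_zero, add_zero, smul_eq_mul, map_mul]
    ring

lemma matrixSubst_sub_sub_mem (LA : Matrix α α k) (C : Matrix α β k) (LB : Matrix β β k)
    {i : ℕ} {q : MvPolynomial (α ⊕ β) k} (hq : q ∈ leftIdeal k α β ^ i) :
    matrixSubst (Matrix.fromBlocks LA C 0 LB) q - matrixSubst (Matrix.fromBlocks LA 0 0 LB) q -
      ∑ f, (∑ e, C e f • X (Sum.inl e)) *
        matrixSubst (Matrix.fromBlocks LA 0 0 LB) (pderiv (Sum.inr f) q) ∈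
      leftIdeal k α β ^ (i + 2) :=
  map_sub_sub_sum_mem (fun f => sum_smul_X_inl_mem _)
    (fun p => by simpa using matrixSubst_sub_mem LA C LB (i := 0) (q := p) (by simp))
    (fun e => by rw [matrixSubst_fromBlocks_X_inl]; exact sum_smul_X_inl_mem _)
    (fun e => by rw [matrixSubst_fromBlocks_X_inl, matrixSubst_fromBlocks_X_inl])
    (fun f => by rw [matrixSubst_fromBlocks_X_inr, matrixSubst_fromBlocks_X_inr]; simp) hq

/-- The contraction `q ↦ ∑ e, ∂_{s e} (D (X (s e) * q))` of an operator `D`. -/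
noncomputable def contract {σ ι : Type*} [Fintype σ] (s : σ → ι)
    (D : MvPolynomial ι k →ₗ[k] MvPolynomial ι k) : MvPolynomial ι k →ₗ[k] MvPolynomial ι k :=
  ∑ e, (pderiv (s e)).toLinearMap ∘ₗ D ∘ₗ LinearMap.mulLeft k (X (s e))

lemma contract_apply {σ ι : Type*} [Fintype σ] (s : σ → ι)
    (D : MvPolynomial ι k →ₗ[k] MvPolynomial ι k) (q : MvPolynomial ι k) :
    contract s D q = ∑ e, pderiv (s e) (D (X (s e) * q)) := by
  simp [contract]

/-- Summing over a basis and its dual basis is independent of the basis. -/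
lemma sum_sum_inv_smul {σ M N : Type*} [Fintype σ] [DecidableEq σ] [AddCommGroup M] [Module k M]
    [AddCommGroup N] [Module k N] {L L' : Matrix σ σ k} (h : L' * L = 1)
    (T : σ → M →ₗ[k] N) (w : σ → M) :
    ∑ e, ∑ f, L' e f • T f (∑ e', L e' e • w e') = ∑ f, T f (w f) := by
  have h' : L * L' = 1 := mul_eq_one_comm.mp h
  rw [Finset.sum_comm]
  refine Finset.sum_congr rfl fun f _ => ?_
  simp_rw [← map_smul, ← map_sum, Finset.smul_sum, smul_smul]
  rw [Finset.sum_comm]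
  simp_rw [← Finset.sum_smul]
  rw [Finset.sum_eq_single f]
  · have := congrFun (congrFun h' f) f
    rw [Matrix.mul_apply] at this
    simp [mul_comm (L' _ _), this]
  · intro e _ he
    have := congrFun (congrFun h' e) f
    rw [Matrix.mul_apply] at this
    simp [mul_comm (L' _ _), this, he]
  · simp

lemma map_pderiv_eq_sum {σ ι : Type*} [Fintype σ] [DecidableEq σ] {s : σ → ι}
    {l : MvPolynomial ι k →ₐ[k] MvPolynomial ι k} {L L' : Matrix σ σ k} (h : L' * L = 1)
    (hl : ∀ e p, pderiv (s e) (l p) = ∑ e', L e e' • l (pderiv (s e') p))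
    (e : σ) (p : MvPolynomial ι k) :
    l (pderiv (s e) p) = ∑ f, L' e f • pderiv (s f) (l p) := by
  simp_rw [hl, Finset.smul_sum, smul_smul]
  rw [Finset.sum_comm]
  simp_rw [← Finset.sum_smul, ← Matrix.mul_apply, h]
  simp [Matrix.one_apply]

/-- The pairing of a family of polynomials with the derivations `∑ f, L' e f • ∂_{s f}`. -/
noncomputable def dualSum {σ ι : Type*} [Fintype σ] (L' : Matrix σ σ k) (s : σ → ι) :
    (σ → MvPolynomial ι k) →ₗ[k] MvPolynomial ι k :=
  ∑ e, ∑ f, L' e f • (pderiv (s f)).toLinearMap ∘ₗ LinearMap.proj e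

lemma dualSum_apply {σ ι : Type*} [Fintype σ] (L' : Matrix σ σ k) (s : σ → ι)
    (E : σ → MvPolynomial ι k) :
    dualSum L' s E = ∑ e, ∑ f, L' e f • pderiv (s f) (E e) := by
  simp [dualSum]

lemma map_contract {σ ι : Type*} [Fintype σ] [DecidableEq σ] {s : σ → ι}
    {l : MvPolynomial ι k →ₐ[k] MvPolynomial ι k} {L L' : Matrix σ σ k} (h : L' * L = 1)
    (hl : ∀ e p, pderiv (s e) (l p) = ∑ e', L e e' • l (pderiv (s e') p))
    (hX : ∀ e, l (X (s e)) = ∑ e', L e' e • X (s e'))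
    (D : MvPolynomial ι k →ₗ[k] MvPolynomial ι k) (q : MvPolynomial ι k) :
    l (contract s D q) - contract s D (l q) =
      dualSum L' s fun e => l (D (X (s e) * q)) - D (l (X (s e) * q)) := by
  rw [dualSum_apply]
  have h1 := sum_sum_inv_smul h
    (fun f => (pderiv (s f)).toLinearMap ∘ₗ D) (fun f => X (s f) * l q)
  simp only [map_sub, smul_sub, Finset.sum_sub_distrib, contract_apply, map_sum,
    map_pderiv_eq_sum h hl]
  congr 1
  refine Eq.trans (by simp) (h1.symm.trans ?_)
  refine Finset.sum_congr rfl fun e _ => Finset.sum_congr rfl fun f _ => ?_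
  simp only [map_mul, hX, Finset.sum_mul, smul_mul_assoc]
  simp

lemma dualSum_map_X_mul {σ ι : Type*} [Fintype σ] [DecidableEq σ] {s : σ → ι}
    {l : MvPolynomial ι k →ₐ[k] MvPolynomial ι k} {L L' : Matrix σ σ k} (h : L' * L = 1)
    (hX : ∀ e, l (X (s e)) = ∑ e', L e' e • X (s e')) (w : MvPolynomial ι k) :
    dualSum L' s (fun e => l (X (s e)) * w) = ∑ f, pderiv (s f) (X (s f) * w) := by
  rw [dualSum_apply]
  have h1 := sum_sum_inv_smul h (fun f => (pderiv (s f)).toLinearMap) (fun f => X (s f) * w)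
  refine Eq.trans ?_ h1
  refine Finset.sum_congr rfl fun e _ => Finset.sum_congr rfl fun f _ => ?_
  simp only [hX, Finset.sum_mul, smul_mul_assoc]
  simp

lemma pderiv_inl_matrixSubst_fromBlocks (LA : Matrix α α k) (LB : Matrix β β k) (e : α)
    (p : MvPolynomial (α ⊕ β) k) :
    pderiv (Sum.inl e) (matrixSubst (Matrix.fromBlocks LA 0 0 LB) p) =
      ∑ e', LA e e' • matrixSubst (Matrix.fromBlocks LA 0 0 LB) (pderiv (Sum.inl e') p) := by
  rw [pderiv_matrixSubst]
  simp [Fintype.sum_sum_type]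

lemma pderiv_inr_matrixSubst_fromBlocks (LA : Matrix α α k) (LB : Matrix β β k) (f : β)
    (p : MvPolynomial (α ⊕ β) k) :
    pderiv (Sum.inr f) (matrixSubst (Matrix.fromBlocks LA 0 0 LB) p) =
      ∑ f', LB f f' • matrixSubst (Matrix.fromBlocks LA 0 0 LB) (pderiv (Sum.inr f') p) := by
  rw [pderiv_matrixSubst]
  simp [Fintype.sum_sum_type]

/-- On polynomials of order at least `i` in the first block and of total degree `i + m`, and up
to higher order terms, the commutator of `D` with the diagonal part of the block triangular
substitution is `κ` times the off-diagonal part of that substitution. -/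
def IsCoboundary (LA : Matrix α α k) (C : Matrix α β k) (LB : Matrix β β k) (i m : ℕ) (κ : k)
    (D : MvPolynomial (α ⊕ β) k →ₗ[k] MvPolynomial (α ⊕ β) k) : Prop :=
  ∀ q ∈ leftIdeal k α β ^ i, q.IsHomogeneous (i + m) →
    matrixSubst (Matrix.fromBlocks LA 0 0 LB) (D q) -
      D (matrixSubst (Matrix.fromBlocks LA 0 0 LB) q) -
      κ • (matrixSubst (Matrix.fromBlocks LA C 0 LB) q -
        matrixSubst (Matrix.fromBlocks LA 0 0 LB) q) ∈ leftIdeal k α β ^ (i + 2)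

variable [DecidableEq α] [DecidableEq β]
  {LA LA' : Matrix α α k} {C : Matrix α β k}
  {LB LB' : Matrix β β k} {i m : ℕ} {κ : k}
  {D : MvPolynomial (α ⊕ β) k →ₗ[k] MvPolynomial (α ⊕ β) k}

omit [Fintype β] [DecidableEq α] [DecidableEq β] in
lemma dualSum_inl_mem (L' : Matrix α α k) {E : α → MvPolynomial (α ⊕ β) k}
    (hE : ∀ e, E e ∈ leftIdeal k α β ^ (i + 1)) :
    dualSum L' Sum.inl E ∈ leftIdeal k α β ^ i := by
  rw [dualSum_apply]
  exact Ideal.sum_mem _ fun e _ => Ideal.sum_mem _ fun f _ =>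
    smul_mem_leftIdeal_pow _ (pderiv_inl_mem f (hE e))

omit [Fintype α] [DecidableEq α] [DecidableEq β] in
lemma dualSum_inr_mem (L' : Matrix β β k) {E : β → MvPolynomial (α ⊕ β) k}
    (hE : ∀ e, E e ∈ leftIdeal k α β ^ i) :
    dualSum L' Sum.inr E ∈ leftIdeal k α β ^ i := by
  rw [dualSum_apply]
  exact Ideal.sum_mem _ fun e _ => Ideal.sum_mem _ fun f _ =>
    smul_mem_leftIdeal_pow _ (pderiv_inr_mem f (hE e))

omit [DecidableEq β] in
lemma IsCoboundary.contract_inl (hA : LA' * LA = 1) (hD : IsCoboundary LA C LB (i + 1) m κ D) :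
    IsCoboundary LA C LB i m (κ * (Fintype.card α + (i + 1 : ℕ))) (contract Sum.inl D) := by
  intro q hq hqh
  have hX (e : α) := matrixSubst_fromBlocks_X_inl LA (0 : Matrix α β k) LB e
  have hXC (e : α) := matrixSubst_fromBlocks_X_inl LA C LB e
  have hw := matrixSubst_sub_mem LA C LB hq
  have hS := map_contract hA (pderiv_inl_matrixSubst_fromBlocks LA LB) hX D q
  have hE (e : α) := hD (X (Sum.inl e) * q) (X_inl_mul_mem e hq)
    (by convert (isHomogeneous_X k (Sum.inl e)).mul hqh using 1; ring)
  have hT := dualSum_map_X_mul (s := Sum.inl) hA hX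
    (matrixSubst (Matrix.fromBlocks LA C 0 LB) q - matrixSubst (Matrix.fromBlocks LA 0 0 LB) q)
  have hF := smul_mem_leftIdeal_pow κ (sum_pderiv_X_inl_mul_sub_mem hw)
  generalize matrixSubst (Matrix.fromBlocks LA C 0 LB) = g at *
  generalize matrixSubst (Matrix.fromBlocks LA 0 0 LB) = l at *
  have hG := dualSum_inl_mem LA' hE
  convert Ideal.add_mem _ hG hF using 1
  have hB : (fun e => g (X (Sum.inl e) * q) - l (X (Sum.inl e) * q)) =
      fun e => l (X (Sum.inl e)) * (g q - l q) := by
    funext e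
    simp only [map_mul, hX, hXC, ← mul_sub]
  have hA : dualSum LA' Sum.inl (fun e => l (D (X (Sum.inl e) * q)) -
      D (l (X (Sum.inl e) * q)) - κ • (g (X (Sum.inl e) * q) - l (X (Sum.inl e) * q))) =
      l (contract Sum.inl D q) - contract Sum.inl D (l q) -
        κ • ∑ f, pderiv (Sum.inl f) (X (Sum.inl f) * (g q - l q)) := by
    rw [hS, ← hT, ← hB, ← map_smul, ← map_sub]
    rfl
  rw [hA, smul_sub κ (∑ _, _), smul_smul]
  abel

omit [DecidableEq α] in
lemma IsCoboundary.contract_inr (hB : LB' * LB = 1) (hD : IsCoboundary LA C LB i (m + 2) κ D) :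
    IsCoboundary LA C LB i (m + 1) (κ * (Fintype.card β + (m + 1 : ℕ)))
      (contract Sum.inr D) := by
  intro q hq hqh
  have hX (f : β) : matrixSubst (Matrix.fromBlocks LA 0 0 LB) (X (Sum.inr f)) =
      ∑ f', LB f' f • X (Sum.inr f') := by
    rw [matrixSubst_fromBlocks_X_inr]; simp
  have hXC (f : β) : matrixSubst (Matrix.fromBlocks LA C 0 LB) (X (Sum.inr f)) =
      ∑ e, C e f • X (Sum.inl e) + matrixSubst (Matrix.fromBlocks LA 0 0 LB) (X (Sum.inr f)) := by
    rw [matrixSubst_fromBlocks_X_inr, hX]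
  have hc (f : β) := sum_smul_X_inl_mem (β := β) fun e => C e f
  have hw := matrixSubst_sub_mem LA C LB hq
  have hwh : (matrixSubst (Matrix.fromBlocks LA C 0 LB) q -
      matrixSubst (Matrix.fromBlocks LA 0 0 LB) q).IsHomogeneous (i + 1 + m) := by
    convert (matrixSubst_isHomogeneous _ hqh).sub (matrixSubst_isHomogeneous _ hqh) using 1
    ring
  have hY := matrixSubst_sub_sub_mem LA C LB hq
  have hS := map_contract hB (pderiv_inr_matrixSubst_fromBlocks LA LB) hX D q
  have hP := fun f => map_pderiv_eq_sum hB (pderiv_inr_matrixSubst_fromBlocks LA LB) f q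
  have hE (f : β) := hD (X (Sum.inr f) * q) (Ideal.mul_mem_left _ _ hq)
    (by convert (isHomogeneous_X k (Sum.inr f)).mul hqh using 1; ring)
  have hT := dualSum_map_X_mul (s := Sum.inr) hB hX
    (matrixSubst (Matrix.fromBlocks LA C 0 LB) q - matrixSubst (Matrix.fromBlocks LA 0 0 LB) q)
  have hF := smul_mem_leftIdeal_pow κ (sum_pderiv_X_inr_mul_sub_mem hw hwh)
  generalize matrixSubst (Matrix.fromBlocks LA C 0 LB) = g at *
  generalize matrixSubst (Matrix.fromBlocks LA 0 0 LB) = l at *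
  have hcd (e f : β) : pderiv (Sum.inr f)
      (∑ e', C e' e • (X (Sum.inl e') : MvPolynomial (α ⊕ β) k)) = 0 := by
    simp only [map_sum, Derivation.map_smul]
    exact Finset.sum_eq_zero fun e' _ => by rw [pderiv_X_of_ne (by simp), smul_zero]
  obtain ⟨c, hc'⟩ : ∃ c : β → MvPolynomial (α ⊕ β) k,
    ∀ f, ∑ e, C e f • X (Sum.inl e) = c f := ⟨_, fun _ => rfl⟩
  simp only [hc'] at hXC hc hY hcd
  have hG := dualSum_inr_mem LB' hE
  have hB' : (fun f => g (X (Sum.inr f) * q) - l (X (Sum.inr f) * q)) =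
      (fun f => c f * l q) + (fun f => c f * (g q - l q)) +
        fun f => l (X (Sum.inr f)) * (g q - l q) := by
    funext f
    simp only [map_mul, hXC, Pi.add_apply]
    ring
  have hcw : dualSum LB' Sum.inr (fun f => c f * (g q - l q)) ∈ leftIdeal k α β ^ (i + 2) :=
    dualSum_inr_mem LB' fun f => by
      rw [pow_succ']
      exact Ideal.mul_mem_mul (hc f) hw
  have hcl : dualSum LB' Sum.inr (fun f => c f * l q) =
      ∑ f, c f * l (pderiv (Sum.inr f) q) := by
    simp only [dualSum_apply, Derivation.leibniz, hcd, hP, mul_zero, add_zero, smul_eq_mul,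
      Finset.mul_sum, mul_smul_comm]
  convert Ideal.add_mem _ (Ideal.add_mem _ hG hF) (Ideal.sub_mem _
    (smul_mem_leftIdeal_pow κ hcw) (smul_mem_leftIdeal_pow κ hY)) using 1
  have hA : dualSum LB' Sum.inr (fun f => l (D (X (Sum.inr f) * q)) -
      D (l (X (Sum.inr f) * q)) - κ • (g (X (Sum.inr f) * q) - l (X (Sum.inr f) * q))) =
      l (contract Sum.inr D q) - contract Sum.inr D (l q) -
        κ • (∑ f, c f * l (pderiv (Sum.inr f) q) +
          dualSum LB' Sum.inr (fun f => c f * (g q - l q)) +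
          ∑ f, pderiv (Sum.inr f) (X (Sum.inr f) * (g q - l q))) := by
    rw [hS, ← hT, ← hcl, ← map_add, ← map_add, ← hB', ← map_smul, ← map_sub]
    rfl
  rw [hA]
  simp only [smul_sub, smul_add, smul_smul, mul_add, add_smul, Nat.cast_add, Nat.cast_one,
    mul_one]
  abel

omit [DecidableEq β] in
lemma IsCoboundary.iterate_contract_inl (hA : LA' * LA = 1) (j : ℕ)
    (hD : IsCoboundary LA C LB (i + j) m κ D) :
    IsCoboundary LA C LB i m
      (κ * ∏ t ∈ Finset.range j, ((Fintype.card α : k) + (i + t + 1 : ℕ)))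
      ((contract Sum.inl)^[j] D) := by
  induction j generalizing κ D with
  | zero => simpa using hD
  | succ j ih =>
    have h := ih (IsCoboundary.contract_inl hA hD)
    rw [Finset.prod_range_succ, mul_comm (∏ _ ∈ _, _), ← mul_assoc, Function.iterate_succ_apply]
    exact h

omit [DecidableEq α] in
lemma IsCoboundary.iterate_contract_inr (hB : LB' * LB = 1) (j : ℕ)
    (hD : IsCoboundary LA C LB i (m + j + 1) κ D) :
    IsCoboundary LA C LB i (m + 1)
      (κ * ∏ t ∈ Finset.range j, ((Fintype.card β : k) + (m + t + 1 : ℕ)))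
      ((contract Sum.inr)^[j] D) := by
  induction j generalizing κ D with
  | zero => simpa using hD
  | succ j ih =>
    have h := ih (IsCoboundary.contract_inr hB hD)
    rw [Finset.prod_range_succ, mul_comm (∏ _ ∈ _, _), ← mul_assoc, Function.iterate_succ_apply]
    exact h

/-- The matrix of the linear part of an operator, from the second to the first block. -/
noncomputable def linearPart (D : MvPolynomial (α ⊕ β) k →ₗ[k] MvPolynomial (α ⊕ β) k) :
    Matrix α β k :=
  Matrix.of fun e f => constantCoeff (pderiv (Sum.inl e) (D (X (Sum.inr f))))

omit [DecidableEq α] [DecidableEq β] in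
lemma IsCoboundary.linearPart_eq (hD : IsCoboundary LA C LB 0 1 κ D) :
    LA * linearPart D - linearPart D * LB = κ • C := by
  classical
  ext e f
  have h := constantCoeff_eq_zero_of_mem_leftIdeal (by
    simpa using pderiv_inl_mem (i := 1) e (hD (X (Sum.inr f)) (by simp)
      (isHomogeneous_X k _)))
  simpa [pderiv_inl_matrixSubst_fromBlocks, Fintype.sum_sum_type, pderiv_X, Pi.single_apply,
    constantCoeff_smul, constantCoeff_matrixSubst, apply_ite constantCoeff, linearPart,
    Matrix.mul_apply, sub_eq_zero, mul_comm] using h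

omit [DecidableEq α] [DecidableEq β] in
/-- An equivariant projection onto the polynomials of order at least `i + 1` is a coboundary. -/
lemma isCoboundary_of_projection
    (hproj : ∀ q ∈ leftIdeal k α β ^ (i + 1), q.IsHomogeneous (i + m) → D q = q)
    (hmem : ∀ q, q.IsHomogeneous (i + m) → D q ∈ leftIdeal k α β ^ (i + 1))
    (hcomm : ∀ q, q.IsHomogeneous (i + m) →
      matrixSubst (Matrix.fromBlocks LA C 0 LB) (D q) =
        D (matrixSubst (Matrix.fromBlocks LA C 0 LB) q)) :
    IsCoboundary LA C LB i m 1 D := by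
  intro q hq hqh
  have h1 := matrixSubst_sub_mem LA C LB (hmem q hqh)
  have h2 := hproj _ (matrixSubst_sub_mem LA C LB hq)
    ((matrixSubst_isHomogeneous _ hqh).sub (matrixSubst_isHomogeneous _ hqh))
  rw [map_sub, ← hcomm q hqh] at h2
  convert Ideal.neg_mem_iff _ |>.2 h1 using 1
  rw [one_smul, ← h2]
  abel

lemma IsCoboundary.linearPart_iterate_contract_eq (hA : LA' * LA = 1) (hB : LB' * LB = 1)
    (hD : IsCoboundary LA C LB i (m + 1) 1 D) :
    LA * linearPart ((contract Sum.inr)^[m] ((contract Sum.inl)^[i] D)) -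
      linearPart ((contract Sum.inr)^[m] ((contract Sum.inl)^[i] D)) * LB =
      ((∏ t ∈ Finset.range i, ((Fintype.card α : k) + (t + 1 : ℕ))) *
        ∏ t ∈ Finset.range m, ((Fintype.card β : k) + (t + 1 : ℕ))) • C := by
  have h1 : IsCoboundary LA C LB (0 + i) (0 + m + 1) 1 D := by simpa using hD
  have h2 := ((h1.iterate_contract_inl hA).iterate_contract_inr hB m).linearPart_eq
  simpa using h2

end PolynomialOperators

lemma exists_prod_mul_prod_ne_zero {k : Type*} [Field k] (a b : k) {n : ℕ} (hn : 1 ≤ n)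
    (h : ∀ j : ℕ, 2 ≤ j → j ≤ n → a + b ≠ -(j : k)) :
    ∃ i m : ℕ, i + m + 1 = n ∧ (∏ t ∈ Finset.range i, (a + (t + 1 : ℕ))) *
      ∏ t ∈ Finset.range m, (b + (t + 1 : ℕ)) ≠ 0 := by
  by_cases H : ∀ t < n - 1, a + (t + 1 : ℕ) ≠ 0
  · refine ⟨n - 1, 0, by omega, ?_⟩
    simpa [Finset.prod_eq_zero_iff] using H
  · classical
    push Not at H
    obtain ⟨hlt, h0⟩ := Nat.find_spec H
    refine ⟨Nat.find H, n - 1 - Nat.find H, by omega, mul_ne_zero ?_ ?_⟩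
    · refine Finset.prod_ne_zero_iff.2 fun t ht ht0 => ?_
      have ht' := Finset.mem_range.1 ht
      exact Nat.find_min H ht' ⟨by omega, ht0⟩
    · refine Finset.prod_ne_zero_iff.2 fun t ht ht0 => ?_
      have ht' := Finset.mem_range.1 ht
      refine h ((Nat.find H + 1) + (t + 1)) (by omega) (by omega) ?_
      rw [eq_neg_iff_add_eq_zero, Nat.cast_add]
      linear_combination h0 + ht0

section Projections

variable {k G V : Type*} [Field k] [Group G] [AddCommGroup V] [Module k V]
  (ρ : Representation k G V)

lemma exists_equivariant_projection
    (hss : IsSemisimpleModule (MonoidAlgebra k G) ρ.asModule) (W : Submodule k V)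
    (hW : ∀ g, ∀ w ∈ W, ρ g w ∈ W) :
    ∃ P : V →ₗ[k] V, (∀ x, P x ∈ W) ∧ (∀ x ∈ W, P x = x) ∧ ∀ g x, P (ρ g x) = ρ g (P x) := by
  rw [← Representation.isSemisimpleRepresentation_iff_isSemisimpleModule_asModule] at hss
  obtain ⟨W', hc⟩ := exists_isCompl (⟨W, fun g w hw => hW g w hw⟩ : Subrepresentation ρ)
  have hc' : IsCompl W W'.toSubmodule := by
    refine IsCompl.of_eq ?_ ?_
    · exact congrArg Subrepresentation.toSubmodule hc.inf_eq_bot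
    · exact congrArg Subrepresentation.toSubmodule hc.sup_eq_top
  have h1 (y) (hy : y ∈ W) : (W.projectionOnto _ hc' y : V) = y :=
    congrArg Subtype.val (Submodule.projectionOnto_apply_left hc' ⟨y, hy⟩)
  have h2 (y) (hy : y ∈ W'.toSubmodule) : W.projectionOnto _ hc' y = 0 :=
    (Submodule.projectionOnto_apply_eq_zero_iff hc').2 hy
  refine ⟨W.subtype ∘ₗ W.projectionOnto _ hc', fun x => Submodule.coe_mem _, h1, fun g x => ?_⟩
  obtain ⟨w, hw, w', hw', rfl⟩ : ∃ w ∈ W, ∃ w' ∈ W'.toSubmodule, w + w' = x :=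
    Submodule.mem_sup.1 (hc'.sup_eq_top ▸ Submodule.mem_top)
  simp [h1 w hw, h2 w' hw', h1 _ (hW g w hw), h2 _ (W'.apply_mem_toSubmodule g hw')]

lemma isSemisimpleModule_of_equivariant_projections
    (h : ∀ W : Submodule k V, (∀ g, ∀ w ∈ W, ρ g w ∈ W) → ∃ P : V →ₗ[k] V,
      (∀ x, P x ∈ W) ∧ (∀ x ∈ W, P x = x) ∧ ∀ g x, P (ρ g x) = ρ g (P x)) :
    IsSemisimpleModule (MonoidAlgebra k G) ρ.asModule := by
  rw [← Representation.isSemisimpleRepresentation_iff_isSemisimpleModule_asModule]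
  refine ⟨fun W => ?_⟩
  obtain ⟨P, hmem, hproj, hcomm⟩ := h W.toSubmodule fun g w hw => W.apply_mem_toSubmodule g hw
  refine ⟨⟨LinearMap.ker P, fun g x hx => ?_⟩, IsCompl.of_eq ?_ ?_⟩
  · rw [LinearMap.mem_ker] at hx ⊢
    rw [hcomm, hx, map_zero]
  · apply Subrepresentation.toSubmodule_injective
    refine (Submodule.eq_bot_iff _).2 fun x hx => ?_
    exact (hproj x hx.1).symm.trans hx.2
  · apply Subrepresentation.toSubmodule_injective
    rw [Subrepresentation.toSubmodule_sup]
    refine (Submodule.eq_top_iff').2 fun x => Submodule.mem_sup.2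
      ⟨P x, hmem x, x - P x, ?_, by simp⟩
    simp [hproj _ (hmem x)]

end Projections

section SymPow

open MvPolynomial

variable {k V ι : Type*} [Field k] [AddCommGroup V] [Module k V]

/-- The map `Symⁿ V → k[X_j]` determined by a basis of `V`. -/
noncomputable def symPowToPoly (v : Module.Basis ι k V) (n : ℕ) :
    SymPow k V n →ₗ[k] MvPolynomial ι k :=
  (symRelations k V n).liftQ
    (PiTensorProduct.lift ((MultilinearMap.mkPiAlgebra k (Fin n) (MvPolynomial ι k)).compLinearMap
      fun _ => v.constr k X)) (by
    rw [symRelations, Submodule.span_le]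
    rintro _ ⟨σ, w, rfl⟩
    simp only [SetLike.mem_coe, LinearMap.mem_ker, map_sub, PiTensorProduct.lift.tprod,
      MultilinearMap.compLinearMap_apply, MultilinearMap.mkPiAlgebra_apply, Function.comp_apply]
    rw [Equiv.prod_comp σ fun i => v.constr k X (w i), sub_self])

lemma symPowToPoly_mk_tprod (v : Module.Basis ι k V) (n : ℕ) (w : Fin n → V) :
    symPowToPoly v n (Submodule.Quotient.mk (PiTensorProduct.tprod k w)) =
      ∏ i, v.constr k (X : ι → MvPolynomial ι k) (w i) := by
  rw [symPowToPoly, Submodule.liftQ_apply]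
  simp

lemma symPowToPoly_symPowMapAux [Fintype ι] [DecidableEq ι] (v : Module.Basis ι k V) (n : ℕ)
    (f : V →ₗ[k] V) (s : SymPow k V n) :
    symPowToPoly v n (symPowMapAux n f s) =
      matrixSubst (LinearMap.toMatrix v v f) (symPowToPoly v n s) := by
  have hf : v.constr k (X : ι → MvPolynomial ι k) ∘ₗ f =
      (matrixSubst (LinearMap.toMatrix v v f)).toLinearMap ∘ₗ v.constr k X := by
    refine v.ext fun j => ?_
    conv_lhs => rw [LinearMap.comp_apply, ← v.sum_repr (f (v j))]
    simp [LinearMap.toMatrix_apply]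
  suffices symPowToPoly v n ∘ₗ symPowMapAux n f =
      (matrixSubst (LinearMap.toMatrix v v f)).toLinearMap ∘ₗ symPowToPoly v n from
    LinearMap.congr_fun this s
  refine Submodule.linearMap_qext _ (PiTensorProduct.ext ?_)
  ext1 w
  have h : symPowMapAux n f (Submodule.Quotient.mk (PiTensorProduct.tprod k w)) =
      Submodule.Quotient.mk (PiTensorProduct.tprod k fun i => f (w i)) := by
    simp [symPowMapAux]
  simp only [LinearMap.compMultilinearMap_apply, LinearMap.comp_apply, Submodule.mkQ_apply,
    AlgHom.toLinearMap_apply]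
  rw [h, symPowToPoly_mk_tprod, symPowToPoly_mk_tprod, map_prod]
  exact Finset.prod_congr rfl fun i _ => LinearMap.congr_fun hf (w i)

lemma mem_range_symPowToPoly (v : Module.Basis ι k V) {n : ℕ} {q : MvPolynomial ι k}
    (hq : q.IsHomogeneous n) : q ∈ LinearMap.range (symPowToPoly v n) := by
  rw [q.as_sum]
  refine Submodule.sum_mem _ fun d hd => ?_
  have hdn : d.degree = n := by
    by_contra h
    exact (mem_support_iff.1 hd) (hq.coeff_eq_zero h)
  rw [← mul_one (coeff d q), ← smul_eq_mul, ← smul_monomial]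
  refine Submodule.smul_mem _ _ ?_
  have hlen : d.toMultiset.toList.length = n := by
    rw [Multiset.length_toList, Finsupp.card_toMultiset, ← hdn]
    rfl
  refine ⟨Submodule.Quotient.mk (PiTensorProduct.tprod k fun i =>
    v (d.toMultiset.toList.get (i.cast hlen.symm))), ?_⟩
  rw [symPowToPoly_mk_tprod]
  simp only [Module.Basis.constr_basis]
  subst hlen
  have h1 : ∏ i, (X (d.toMultiset.toList.get i) : MvPolynomial ι k) =
      (d.toMultiset.toList.map X).prod := by
    rw [← List.prod_ofFn]
    exact congrArg List.prod (List.ofFn_getElem_eq_map _ _)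
  refine h1.trans ?_
  rw [← Multiset.prod_coe, ← Multiset.map_coe, Multiset.coe_toList, monomial_eq, C_1, one_mul,
    Finsupp.toMultiset_map, Finsupp.prod_toMultiset]
  exact Finsupp.prod_mapDomain_index (by simp) (by simp [pow_add])

end SymPow

section Representations

variable {k G V : Type*} [Field k] [Group G] [AddCommGroup V] [Module k V]
  {ρ : Representation k G V}

lemma exists_isCoboundary {α β : Type*} [Fintype α] [Fintype β] [DecidableEq α] [DecidableEq β]
    {i m : ℕ} (hss : IsSemisimpleModule (MonoidAlgebra k G) (symPowRep ρ (i + m)).asModule)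
    (v : Module.Basis (α ⊕ β) k V) {LA : G → Matrix α α k} {C : G → Matrix α β k}
    {LB : G → Matrix β β k}
    (hM : ∀ g, LinearMap.toMatrix v v (ρ g) = Matrix.fromBlocks (LA g) (C g) 0 (LB g)) :
    ∃ D : MvPolynomial (α ⊕ β) k →ₗ[k] MvPolynomial (α ⊕ β) k,
      ∀ g, IsCoboundary (LA g) (C g) (LB g) i m 1 D := by
  have hF (g s) : symPowToPoly v (i + m) (symPowRep ρ (i + m) g s) =
      matrixSubst (Matrix.fromBlocks (LA g) (C g) 0 (LB g)) (symPowToPoly v (i + m) s) := by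
    rw [← hM]
    exact symPowToPoly_symPowMapAux v _ _ s
  obtain ⟨P, hmem, hproj, hcomm⟩ := exists_equivariant_projection _ hss
    (((leftIdeal k α β ^ (i + 1)).restrictScalars k).comap (symPowToPoly v (i + m)))
    fun g w hw => by
      rw [Submodule.mem_comap, hF]
      exact matrixSubst_fromBlocks_mem _ _ _ hw
  obtain ⟨Ψ₀, hΨ₀⟩ := (symPowToPoly v (i + m)).rangeRestrict.exists_rightInverse_of_surjective
    (LinearMap.range_rangeRestrict _)
  obtain ⟨Ψ, hΨ⟩ := Ψ₀.exists_extend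
  have hsec (q : MvPolynomial (α ⊕ β) k) (hq : q.IsHomogeneous (i + m)) :
      symPowToPoly v (i + m) (Ψ q) = q := by
    have h1 := LinearMap.congr_fun hΨ ⟨q, mem_range_symPowToPoly v hq⟩
    have h2 := LinearMap.congr_fun hΨ₀ ⟨q, mem_range_symPowToPoly v hq⟩
    rw [LinearMap.comp_apply, Submodule.subtype_apply] at h1
    rw [h1]
    exact congrArg Subtype.val h2
  refine ⟨symPowToPoly v (i + m) ∘ₗ P ∘ₗ Ψ, fun g => isCoboundary_of_projection
    (fun q hq hqh => ?_) (fun q _ => hmem _) fun q hqh => ?_⟩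
  · rw [LinearMap.comp_apply, LinearMap.comp_apply, hproj, hsec q hqh]
    rw [Submodule.mem_comap, hsec q hqh]
    exact hq
  · have hker : symPowToPoly v (i + m)
        (Ψ (matrixSubst (Matrix.fromBlocks (LA g) (C g) 0 (LB g)) q) -
          symPowRep ρ (i + m) g (Ψ q)) = 0 := by
      rw [map_sub, hF, hsec q hqh, hsec _ (matrixSubst_isHomogeneous _ hqh), sub_self]
    have h := hproj _ (show _ ∈ Submodule.comap _ _ by
      rw [Submodule.mem_comap, hker]
      exact zero_mem _)
    rw [map_sub, hcomm] at h
    rw [← h, map_sub, hF, sub_eq_zero] at hker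
    exact hker.symm

lemma exists_equivariant_projection_of_symPow [FiniteDimensional k V] {n : ℕ} (hn : 1 ≤ n)
    (hss : IsSemisimpleModule (MonoidAlgebra k G) (symPowRep ρ n).asModule)
    (hdim : ∀ i : ℕ, 2 ≤ i → i ≤ n → (Module.finrank k V : k) ≠ -(i : k))
    (W : Submodule k V) (hW : ∀ g, ∀ w ∈ W, ρ g w ∈ W) :
    ∃ P : V →ₗ[k] V, (∀ x, P x ∈ W) ∧ (∀ x ∈ W, P x = x) ∧ ∀ g x, P (ρ g x) = ρ g (P x) := by
  obtain ⟨W', hc⟩ := W.exists_isCompl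
  have hcard : (Module.finrank k W : k) + Module.finrank k W' = Module.finrank k V := by
    rw [← Nat.cast_add, Submodule.finrank_add_eq_of_isCompl hc]
  obtain ⟨i, m, rfl, hκ⟩ := exists_prod_mul_prod_ne_zero (Module.finrank k W : k)
    (Module.finrank k W' : k) hn (by rwa [hcard])
  let v := ((Module.finBasis k W).prod (Module.finBasis k W')).map (W.prodEquivOfIsCompl W' hc)
  have hvl (e) : v (Sum.inl e) = Module.finBasis k W e := by simp [v]
  have hrepr (w) (hw : w ∈ W) (f) : v.repr w (Sum.inr f) = 0 := by
    simp [v, (Submodule.projectionOnto_apply_eq_zero_iff hc.symm).2 hw]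
  have hM (g) : LinearMap.toMatrix v v (ρ g) = Matrix.fromBlocks
      (LinearMap.toMatrix v v (ρ g)).toBlocks₁₁ (LinearMap.toMatrix v v (ρ g)).toBlocks₁₂ 0
      (LinearMap.toMatrix v v (ρ g)).toBlocks₂₂ := by
    conv_lhs => rw [← Matrix.fromBlocks_toBlocks (LinearMap.toMatrix v v (ρ g))]
    congr 1
    ext f e
    simp only [Matrix.toBlocks₂₁, Matrix.of_apply, LinearMap.toMatrix_apply, Matrix.zero_apply]
    exact hrepr _ (hW g _ (by simp [hvl])) f
  obtain ⟨D, hD⟩ := exists_isCoboundary (i := i) (m := m + 1) hss v hM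
  obtain ⟨κ, hκ0, ψ, hψ⟩ : ∃ κ : k, κ ≠ 0 ∧
      ∃ ψ : Matrix (Fin (Module.finrank k W)) (Fin (Module.finrank k W')) k,
        ∀ g, (LinearMap.toMatrix v v (ρ g)).toBlocks₁₁ * ψ -
          ψ * (LinearMap.toMatrix v v (ρ g)).toBlocks₂₂ =
          κ • (LinearMap.toMatrix v v (ρ g)).toBlocks₁₂ := by
    refine ⟨_, hκ, linearPart ((contract Sum.inr)^[m] ((contract Sum.inl)^[i] D)), fun g => ?_⟩
    have hinv : LinearMap.toMatrix v v (ρ g⁻¹) * LinearMap.toMatrix v v (ρ g) = 1 := by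
      rw [← LinearMap.toMatrix_mul, ← map_mul, inv_mul_cancel, map_one, LinearMap.toMatrix_one]
    rw [hM g, hM g⁻¹, Matrix.fromBlocks_multiply, ← Matrix.fromBlocks_one,
      Matrix.fromBlocks_inj] at hinv
    rw [(hD g).linearPart_iterate_contract_eq (by simpa using hinv.1)
      (by simpa using hinv.2.2.2), Fintype.card_fin, Fintype.card_fin]
  obtain ⟨φ, hφ⟩ : ∃ φ : Matrix (Fin (Module.finrank k W)) (Fin (Module.finrank k W')) k,
      ∀ g, (LinearMap.toMatrix v v (ρ g)).toBlocks₁₁ * φ -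
        φ * (LinearMap.toMatrix v v (ρ g)).toBlocks₂₂ =
        (LinearMap.toMatrix v v (ρ g)).toBlocks₁₂ :=
    ⟨κ⁻¹ • ψ, fun g => by
      rw [Matrix.mul_smul, Matrix.smul_mul, ← smul_sub, hψ, inv_smul_smul₀ hκ0]⟩
  let P : V →ₗ[k] V := Matrix.toLin v v (Matrix.fromBlocks 1 φ 0 0)
  have hPl (e) : P (v (Sum.inl e)) = v (Sum.inl e) := by
    simp [P, Matrix.toLin_self, Matrix.one_apply]
  refine ⟨P, fun x => ?_, fun x hx => ?_, fun g x => ?_⟩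
  · rw [← v.sum_repr x, map_sum]
    refine Submodule.sum_mem _ fun j _ => ?_
    rw [map_smul, Matrix.toLin_self]
    refine Submodule.smul_mem _ _ (Submodule.sum_mem _ fun j' _ => ?_)
    cases j' with
    | inl e => exact Submodule.smul_mem _ _ (by simp [hvl])
    | inr f => cases j <;> simp
  · rw [← v.sum_repr x, Fintype.sum_sum_type]
    simp [hrepr x hx, hPl]
  · have h : P * ρ g = ρ g * P := by
      apply (LinearMap.toMatrix v v).injective
      rw [LinearMap.toMatrix_mul, LinearMap.toMatrix_mul, LinearMap.toMatrix_toLin, hM g,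
        Matrix.fromBlocks_multiply, Matrix.fromBlocks_multiply]
      simp [← hφ g]
    exact LinearMap.congr_fun h x

end Representations

/-- Let `G` be a group, `n ≥ 1`, and `k` a field of characteristic `0`
or `> n`.  Let `V` be a finite dimensional representation of `G` over `k`.  If the
induced representation on the `n`-th symmetric power `Symⁿ V` is semisimple and the
image of `dim_k V` in `k` is different from the images of `-n, -(n-1), …, -2`, then `V`
is semisimple. -/
theorem semisimple_of_symmetricPower_semisimple
    {k : Type*} [Field k] {G : Type*} [Group G] (n : ℕ) (hn : 1 ≤ n)
    (hchar : ringChar k = 0 ∨ n < ringChar k)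
    {V : Type*} [AddCommGroup V] [Module k V] [FiniteDimensional k V]
    (ρ : Representation k G V)
    (hss : IsSemisimpleModule (MonoidAlgebra k G) (symPowRep ρ n).asModule)
    (hdim : ∀ i : ℕ, 2 ≤ i → i ≤ n → (Module.finrank k V : k) ≠ -(i : k)) :
    IsSemisimpleModule (MonoidAlgebra k G) ρ.asModule :=
  isSemisimpleModule_of_equivariant_projections ρ fun W hW =>
    exists_equivariant_projection_of_symPow hn hss hdim W hW
end
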